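/- There exists a constant C, depending only on n and Ω, such that for every map u continuously differentiable up to the boundary of Ω with values in ℝ^n and every ψ ∈ C^1_c(Ω), one has |∫_Ω det∇u(x) ψ(x) dx| ≤ C ‖u‖_{W^{n/(n+1),n+1}(Ω)}^n ‖ψ‖_{W^{n/(n+1),n+1}(Ω)}. (Hence for u ∈ W^{n/(n+1),n+1}(Ω;ℝ^n) the distributional Jacobian Ju extends to a bounded linear functional on W^{n/(n+1),n+1}(Ω).) -/

import Mathlib

open MeasureTheory Metric Filter Topology

noncomputable section

abbrev Euc (n : ℕ) := EuclideanSpace ℝ (Fin n)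

/-- The Jacobian matrix `∇u(x)` of a map `u : ℝⁿ → ℝⁿ`, with entries `∂_j u_i (x)`. -/
def jacMat (n : ℕ) (u : Euc n → Euc n) (x : Euc n) : Matrix (Fin n) (Fin n) ℝ :=
  Matrix.of fun i j => fderiv ℝ u x (EuclideanSpace.single j 1) i

/-- The vector field `j u := (1/n) (cof ∇u)ᵀ u` (componentwise); note that
`(cof A)ᵀ = adjugate A`. -/
def jvec (n : ℕ) (u : Euc n → Euc n) (x : Euc n) : Fin n → ℝ :=
  fun i => (n : ℝ)⁻¹ * Matrix.mulVec (Matrix.adjugate (jacMat n u x)) (fun j => u x j) i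

/-- The pointwise pairing `j u (x) · ∇ψ(x)`. -/
def jPair (n : ℕ) (u : Euc n → Euc n) (ψ : Euc n → ℝ) (x : Euc n) : ℝ :=
  ∑ i, jvec n u x i * fderiv ℝ ψ x (EuclideanSpace.single i 1)

/-- `ψ ∈ C¹_c(Ω)`. -/
def Cc1 (n : ℕ) (Ω : Set (Euc n)) (ψ : Euc n → ℝ) : Prop :=
  ContDiff ℝ 1 ψ ∧ HasCompactSupport ψ ∧ tsupport ψ ⊆ Ω

/-- The fractional Sobolev seminorm `[u]_{W^{s,p}(Ω)}`. -/
def sobSemi (n : ℕ) (s p : ℝ) (Ω : Set (Euc n)) {F : Type*} [NormedAddCommGroup F]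
    (u : Euc n → F) : ℝ :=
  (∫ x in Ω, ∫ y in Ω, ‖u x - u y‖ ^ p / dist x y ^ ((n : ℝ) + s * p)) ^ (1 / p)

/-- The fractional Sobolev norm `‖u‖_{W^{s,p}(Ω)} = ‖u‖_{L^p(Ω)} + [u]_{W^{s,p}(Ω)}`. -/
def sobNorm (n : ℕ) (s p : ℝ) (Ω : Set (Euc n)) {F : Type*} [NormedAddCommGroup F]
    (u : Euc n → F) : ℝ :=
  (∫ x in Ω, ‖u x‖ ^ p) ^ (1 / p) + sobSemi n s p Ω u

/-- Membership `u ∈ W^{s,p}(Ω; F)`: `u ∈ L^p(Ω)` and the double integral defining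
`[u]_{W^{s,p}(Ω)}^p` is finite. -/
def MemWsp (n : ℕ) (s p : ℝ) (Ω : Set (Euc n)) {F : Type*} [NormedAddCommGroup F]
    (u : Euc n → F) : Prop :=
  AEStronglyMeasurable u (volume.restrict Ω) ∧
  Integrable (fun x => ‖u x‖ ^ p) (volume.restrict Ω) ∧
  Integrable (fun q : Euc n × Euc n => ‖u q.1 - u q.2‖ ^ p / dist q.1 q.2 ^ ((n : ℝ) + s * p))
    ((volume.restrict Ω).prod (volume.restrict Ω))

/-- `Ω` has smooth boundary: it is a sublevel set of a smooth function whose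
differential does not vanish on the boundary. -/
def SmoothBoundary (n : ℕ) (Ω : Set (Euc n)) : Prop :=
  ∃ f : Euc n → ℝ, ContDiff ℝ (⊤ : ℕ∞) f ∧ Ω = f ⁻¹' Set.Iio 0 ∧
    ∀ x ∈ frontier Ω, fderiv ℝ f x ≠ 0

/-- `u^a(x) = (u(x) - a)/|u(x) - a|`. -/
def proj (n : ℕ) (u : Euc n → Euc n) (a : Euc n) : Euc n → Euc n :=
  fun x => ‖u x - a‖⁻¹ • (u x - a)

/-- The set of Hölder quotients of `u` on `Ω`. -/
def holderSet (n : ℕ) (α : ℝ) (Ω : Set (Euc n)) {F : Type*} [NormedAddCommGroup F]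
    (u : Euc n → F) : Set ℝ :=
  {r | ∃ x ∈ Ω, ∃ y ∈ Ω, x ≠ y ∧ r = ‖u x - u y‖ / dist x y ^ α}

/-- The Hölder seminorm `[u]_{C^{0,α}(Ω)}`. -/
def holderSemi (n : ℕ) (α : ℝ) (Ω : Set (Euc n)) {F : Type*} [NormedAddCommGroup F]
    (u : Euc n → F) : ℝ :=
  sSup (holderSet n α Ω u)

/-- The Hölder norm `‖u‖_{C^{0,α}(Ω)} = sup_Ω ‖u‖ + [u]_{C^{0,α}(Ω)}`. -/
def holderNorm (n : ℕ) (α : ℝ) (Ω : Set (Euc n)) {F : Type*} [NormedAddCommGroup F]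
    (u : Euc n → F) : ℝ :=
  sSup {r | ∃ x ∈ Ω, r = ‖u x‖} + holderSemi n α Ω u

/-- the volume `ω_n` of the unit ball of `ℝⁿ`. -/
def ballVol (n : ℕ) : ℝ := (volume (ball (0 : Euc n) 1)).toReal

/-- `⟨Jv, ψ⟩ = J` for `v ∈ W^{(n-1)/n, n}(Ω; ℝⁿ)`: approximating sequences of maps which are
`C¹` up to the boundary exist, and for every such sequence the Jacobian integrals converge
to `J`. -/
def JPairing (n : ℕ) (Ω : Set (Euc n)) (v : Euc n → Euc n) (ψ : Euc n → ℝ) (J : ℝ) : Prop :=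
  (∃ vk : ℕ → Euc n → Euc n, (∀ k, ContDiffOn ℝ 1 (vk k) (closure Ω)) ∧
      Tendsto (fun k => sobNorm n (((n : ℝ) - 1) / n) n Ω (vk k - v)) atTop (𝓝 0) ∧
      Tendsto (fun k => ∫ x in Ω, (jacMat n (vk k) x).det * ψ x) atTop (𝓝 J)) ∧
  (∀ vk : ℕ → Euc n → Euc n, (∀ k, ContDiffOn ℝ 1 (vk k) (closure Ω)) →
      Tendsto (fun k => sobNorm n (((n : ℝ) - 1) / n) n Ω (vk k - v)) atTop (𝓝 0) →
      Tendsto (fun k => ∫ x in Ω, (jacMat n (vk k) x).det * ψ x) atTop (𝓝 J))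

/-- The set of values `⟨Jv, ψ⟩` over test functions `ψ ∈ C¹_c(Ω)` with `|ψ| ≤ 1`;
its supremum is the total variation `|Jv|_{TV}`. -/
def TVset (n : ℕ) (Ω : Set (Euc n)) (v : Euc n → Euc n) : Set ℝ :=
  {r | ∃ ψ : Euc n → ℝ, Cc1 n Ω ψ ∧ (∀ x, |ψ x| ≤ 1) ∧ JPairing n Ω v ψ r}

/-- `⟨Jv, ψ⟩ = -∫_Ω j v · ∇ψ` for (pointwise defined) `v`. -/
def jpairOn (n : ℕ) (Ω : Set (Euc n)) (v : Euc n → Euc n) (ψ : Euc n → ℝ) : ℝ :=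
  -∫ x in Ω, jPair n v ψ x

/-- The `W^{-1,1}(Ω)` distance between two functionals on test functions:
`sup { S ψ - T ψ : ψ ∈ C¹_c(Ω), Lip ψ ≤ 1 }`. -/
def Wm11dist (n : ℕ) (Ω : Set (Euc n)) (S T : (Euc n → ℝ) → ℝ) : ℝ :=
  sSup {r | ∃ ψ : Euc n → ℝ, Cc1 n Ω ψ ∧ LipschitzWith 1 ψ ∧ r = S ψ - T ψ}

/-- The geometric facts about a smooth bounded domain which the proof uses. -/
structure Geom (n : ℕ) (Ω : Set (Euc n)) (d : Euc n → ℝ) (c r : ℝ) : Prop where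
  smooth : ContDiff ℝ (⊤ : ℕ∞) d
  mem : ∀ x, x ∈ Ω ↔ 0 < d x
  le_one : ∀ x ∈ Ω, d x ≤ 1
  grad : ∀ x ∈ Ω, ‖fderiv ℝ d x‖ ≤ 1
  lip : ∀ x ∈ Ω, ∀ y z, dist y x ≤ 1 → dist z x ≤ 1 → |d y - d z| ≤ dist y z
  cpos : 0 < c
  cle : c ≤ 1
  rpos : 0 < r
  rle : r ≤ 1
  dir : ∀ x ∈ Ω, d x < r → ∃ v : Euc n, ‖v‖ ≤ 1 ∧ ∀ y s, dist y x ≤ r → 0 ≤ s →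
    dist (y + s • v) x ≤ r → d y + c * s ≤ d (y + s • v)

theorem Geom.mem_of_dist {n : ℕ} {Ω : Set (Euc n)} {d : Euc n → ℝ} {c r : ℝ} (G : Geom n Ω d c r)
    {x y : Euc n} (hx : x ∈ Ω) (h : dist y x < d x) : y ∈ Ω := by
  have h1 := G.le_one x hx
  have := G.lip x hx y x (by linarith) (by simp)
  rw [G.mem]
  have := abs_le.1 this
  linarith

theorem exists_geom (n : ℕ) (Ω : Set (Euc n)) (hΩo : IsOpen Ω)
    (hΩb : Bornology.IsBounded Ω) (hΩs : SmoothBoundary n Ω) :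
    ∃ d c r, Geom n Ω d c r := by
  obtain ⟨f, hf, hΩf, hfr⟩ := hΩs
  obtain ⟨R, hR⟩ := hΩb.subset_closedBall 0
  set B : Set (Euc n) := closedBall 0 (R + 1) with hB
  have hBc : IsCompact B := isCompact_closedBall _ _
  have hfc : Continuous (fderiv ℝ f) := hf.continuous_fderiv (by simp)
  obtain ⟨L1, hL1⟩ := hBc.exists_bound_of_continuousOn hfc.continuousOn
  obtain ⟨L2, hL2⟩ := hBc.exists_bound_of_continuousOn hf.continuous.continuousOn
  set L := max (max L1 L2) 1 with hL
  have hLpos : 0 < L := lt_of_lt_of_le one_pos (le_max_right _ _)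
  set d : Euc n → ℝ := fun x => (-L⁻¹) * f x with hd
  have hdd : ContDiff ℝ (⊤ : ℕ∞) d := contDiff_const.mul hf
  have hfd : ∀ x, fderiv ℝ d x = (-L⁻¹) • fderiv ℝ f x := fun x => by
    have : DifferentiableAt ℝ f x := hf.differentiable (by simp) x
    simpa [hd] using fderiv_const_mul this (-L⁻¹)
  have hΩB : ∀ x ∈ Ω, ∀ y, dist y x ≤ 1 → y ∈ B := by
    intro x hx y hy
    have h1 := hR hx
    simp only [hB, mem_closedBall] at *
    linarith [dist_triangle y x 0]
  have hgB : ∀ x ∈ B, ‖fderiv ℝ d x‖ ≤ 1 := by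
    intro x hx
    rw [hfd, norm_smul, norm_neg, norm_inv, Real.norm_of_nonneg hLpos.le, inv_mul_le_iff₀ hLpos]
    have := hL1 x hx
    have : L1 ≤ L := (le_max_left _ _).trans (le_max_left _ _)
    linarith
  have hconv : Convex ℝ B := convex_closedBall _ _
  have hmem : ∀ x, x ∈ Ω ↔ 0 < d x := by
    intro x
    rw [hΩf]
    simp only [Set.mem_preimage, Set.mem_Iio, hd]
    have := inv_pos.2 hLpos
    constructor
    · intro h; nlinarith
    · intro h; by_contra h'; push Not at h'; nlinarith
  have hdc : Continuous (fderiv ℝ d) := hdd.continuous_fderiv (by simp)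
  have hddiff : Differentiable ℝ d := hdd.differentiable (by simp)
  -- lower bound
  have hcl : IsCompact (closure Ω) := hΩb.isCompact_closure
  obtain ⟨c, hc, hcb⟩ : ∃ c > 0, ∀ x ∈ closure Ω, c ≤ max (d x) ‖fderiv ℝ d x‖ := by
    rcases (closure Ω).eq_empty_or_nonempty with h | h
    · exact ⟨1, one_pos, by simp [h]⟩
    · obtain ⟨x0, hx0, hmin⟩ := hcl.exists_isMinOn h
        ((hdd.continuous.max hdc.norm).continuousOn (s := closure Ω))
      refine ⟨_, ?_, fun x hx => hmin hx⟩
      show 0 < max (d x0) ‖fderiv ℝ d x0‖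
      by_cases hx : x0 ∈ Ω
      · exact lt_max_of_lt_left ((hmem _).1 hx)
      · apply lt_max_of_lt_right
        rw [hfd, norm_smul]
        have : fderiv ℝ f x0 ≠ 0 := hfr x0 (by rw [frontier, hΩo.interior_eq]; exact ⟨hx0, hx⟩)
        have h2 : (-L⁻¹) ≠ 0 := by simp [hLpos.ne']
        positivity
  have huc := hBc.uniformContinuousOn_of_continuous hdc.continuousOn
  rw [Metric.uniformContinuousOn_iff_le] at huc
  obtain ⟨r0, hr0, hr0b⟩ := huc (c / 4) (by positivity)
  set r := min (min r0 c) 1 with hr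
  have hr_r0 : r ≤ r0 := (min_le_left _ _).trans (min_le_left _ _)
  have hr_c : r ≤ c := (min_le_left _ _).trans (min_le_right _ _)
  have hr1 : r ≤ 1 := min_le_right _ _
  refine ⟨d, min (c / 4) 1, r, hdd, hmem, ?_, ?_, ?_, by positivity, min_le_right _ _,
    by positivity, hr1, ?_⟩
  · intro x hx
    have h1 := hL2 x (hΩB x hx x (by simp))
    have h2 : L2 ≤ L := (le_max_right _ _).trans (le_max_left _ _)
    simp only [hd, Real.norm_eq_abs] at *
    have h3 := (abs_le.1 h1).1
    have : -L⁻¹ * f x = L⁻¹ * (- f x) := by ring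
    rw [this, inv_mul_le_iff₀ hLpos]; linarith
  · intro x hx; exact hgB x (hΩB x hx x (by simp))
  · intro x hx y z hy hz
    have := hconv.norm_image_sub_le_of_norm_fderiv_le (𝕜 := ℝ) (f := d) (C := 1)
      (fun x _ => hddiff x) hgB (hΩB x hx z hz) (hΩB x hx y hy)
    simpa [dist_eq_norm] using this
  · intro x hx hdx
    have h1 : c ≤ ‖fderiv ℝ d x‖ := by
      have := hcb x (subset_closure hx)
      rcases le_max_iff.1 this with h | h
      · linarith
      · exact h
    obtain ⟨v, hv1, hv2⟩ := (fderiv ℝ d x).exists_lt_apply_of_lt_opNorm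
      (show c / 2 < ‖fderiv ℝ d x‖ by linarith)
    obtain ⟨v, hv1, hv2⟩ : ∃ v : Euc n, ‖v‖ ≤ 1 ∧ c / 2 < fderiv ℝ d x v := by
      rcases lt_abs.1 (by simpa using hv2 : c / 2 < |fderiv ℝ d x v|) with h | h
      · exact ⟨v, hv1.le, h⟩
      · exact ⟨-v, by simpa using hv1.le, by simpa using h⟩
    refine ⟨v, hv1, ?_⟩
    intro y s hy hs hys
    have hder : ∀ z, dist z x ≤ r → c / 4 ≤ fderiv ℝ d z v := by
      intro z hz
      have h2 := hr0b z (hΩB x hx z (hz.trans hr1)) x (hΩB x hx x (by simp)) (hz.trans hr_r0)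
      rw [dist_eq_norm] at h2
      have h3 := (fderiv ℝ d z - fderiv ℝ d x).le_of_opNorm_le h2 v
      simp only [_root_.sub_apply, Real.norm_eq_abs] at h3
      have h4 := (abs_le.1 h3).1
      nlinarith
    have hz : ∀ τ ∈ Set.Icc 0 s, dist (y + τ • v) x ≤ r := by
      intro τ hτ
      have hc := (convex_closedBall x r).segment_subset (mem_closedBall.2 hy) (mem_closedBall.2 hys)
      rcases hs.eq_or_lt with h0 | h0
      · have : τ = 0 := le_antisymm (hτ.2.trans h0.symm.le) hτ.1
        simpa [this] using hy
      · apply hc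
        rw [segment_eq_image']
        refine ⟨τ / s, ⟨div_nonneg hτ.1 hs, (div_le_one h0).2 hτ.2⟩, ?_⟩
        simp [smul_smul, div_mul_cancel₀ _ h0.ne']
    have hD : ∀ τ : ℝ, HasDerivAt (fun τ : ℝ => d (y + τ • v)) (fderiv ℝ d (y + τ • v) v) τ := by
      intro τ
      have h1 : HasDerivAt (fun τ : ℝ => y + τ • v) v τ := by
        simpa using ((hasDerivAt_id τ).smul_const v).const_add y
      exact (hddiff (y + τ • v)).hasFDerivAt.comp_hasDerivAt τ h1
    have := (convex_Icc 0 s).mul_sub_le_image_sub_of_le_deriv (f := fun τ : ℝ => d (y + τ • v))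
      (C := min (c/4) 1)
      (fun τ _ => (hD τ).continuousAt.continuousWithinAt)
      (fun τ _ => (hD τ).differentiableAt.differentiableWithinAt)
      (fun τ hτ => by
        rw [(hD τ).deriv]
        exact (min_le_left _ _).trans (hder _ (hz _ (interior_subset hτ))))
      0 ⟨le_rfl, hs⟩ s ⟨hs, le_rfl⟩ hs
    simp at this
    linarith

theorem fderiv_bounded {n : ℕ} {F : Type*} [NormedAddCommGroup F] [NormedSpace ℝ F]
    {Ω : Set (Euc n)} (hΩo : IsOpen Ω) (hΩb : Bornology.IsBounded Ω)
    {u : Euc n → F} (hu : ContDiffOn ℝ 1 u (closure Ω)) :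
    ∃ M, ∀ x ∈ Ω, ‖fderiv ℝ u x‖ ≤ M := by
  have hcl : IsCompact (closure Ω) := hΩb.isCompact_closure
  have := hcl.induction_on (p := fun s => ∃ M, ∀ x ∈ s ∩ Ω, ‖fderiv ℝ u x‖ ≤ M)
    ⟨0, by simp⟩ (fun s t hst ⟨M, hM⟩ => ⟨M, fun x hx => hM x ⟨hst hx.1, hx.2⟩⟩)
    (fun s t ⟨M, hM⟩ ⟨M', hM'⟩ => ⟨max M M', fun x hx => by
      rcases hx with ⟨h | h, h'⟩
      · exact (hM x ⟨h, h'⟩).trans (le_max_left _ _)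
      · exact (hM' x ⟨h, h'⟩).trans (le_max_right _ _)⟩) ?_
  · obtain ⟨M, hM⟩ := this
    exact ⟨M, fun x hx => hM x ⟨subset_closure hx, hx⟩⟩
  · intro x hx
    have h1 : ContDiffWithinAt ℝ (0 + 1) u (closure Ω) x := by simpa using hu x hx
    rw [contDiffWithinAt_succ_iff_hasFDerivWithinAt (by simp)] at h1
    obtain ⟨w, hw, -, f', hf', hcf⟩ := h1
    rw [Set.insert_eq_of_mem hx] at hw
    have hcont : ContinuousWithinAt f' w x := hcf.continuousWithinAt
    have hb : ∀ᶠ y in 𝓝[w] x, ‖f' y‖ < ‖f' x‖ + 1 :=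
      hcont.norm.eventually_lt_const (by linarith)
    have hb' : ∀ᶠ y in 𝓝[closure Ω] x, y ∈ w ∧ ‖f' y‖ < ‖f' x‖ + 1 := by
      have h2 : 𝓝[closure Ω] x ≤ 𝓝[w] x := by
        rw [nhdsWithin_le_iff]; exact hw
      exact Filter.Eventually.and hw (h2 hb)
    rw [eventually_nhdsWithin_iff] at hb'
    obtain ⟨V, hV, hVo, hxV⟩ := _root_.eventually_nhds_iff.1 hb'
    refine ⟨V, mem_nhdsWithin_of_mem_nhds (hVo.mem_nhds hxV), ‖f' x‖ + 1, ?_⟩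
    rintro y ⟨hyV, hyΩ⟩
    have h3 := hV y hyV (subset_closure hyΩ)
    have h4 : w ∈ 𝓝 y := by
      filter_upwards [hVo.mem_nhds hyV, hΩo.mem_nhds hyΩ] with z hz1 hz2
      exact (hV z hz1 (subset_closure hz2)).1
    rw [((hf' y h3.1).hasFDerivAt h4).fderiv]
    exact h3.2.le

theorem Geom.lipschitz {n : ℕ} {F : Type*} [NormedAddCommGroup F] [NormedSpace ℝ F]
    {Ω : Set (Euc n)} {d : Euc n → ℝ} {c r : ℝ} (G : Geom n Ω d c r)
    (hΩo : IsOpen Ω) (hΩb : Bornology.IsBounded Ω)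
    {u : Euc n → F} (hu : ContDiffOn ℝ 1 u (closure Ω)) :
    ∃ M, 0 ≤ M ∧ ∀ x ∈ Ω, ∀ y ∈ Ω, ‖u x - u y‖ ≤ M * dist x y := by
  obtain ⟨M0, hM0⟩ := fderiv_bounded hΩo hΩb hu
  have hcl : IsCompact (closure Ω) := hΩb.isCompact_closure
  obtain ⟨S0, hS0⟩ := hcl.exists_bound_of_continuousOn hu.continuousOn
  set M := max M0 0
  set S := max S0 0
  have hM : ∀ x ∈ Ω, ‖fderiv ℝ u x‖ ≤ M := fun x hx => (hM0 x hx).trans (le_max_left _ _)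
  have hS : ∀ x ∈ Ω, ‖u x‖ ≤ S := fun x hx => (hS0 x (subset_closure hx)).trans (le_max_left _ _)
  have hMn : 0 ≤ M := le_max_right _ _
  have hSn : 0 ≤ S := le_max_right _ _
  have hud : ∀ x ∈ Ω, DifferentiableAt ℝ u x := fun x hx =>
    (hu.differentiableOn (by simp) x (subset_closure hx)).differentiableAt
      (mem_of_superset (hΩo.mem_nhds hx) subset_closure)
  have hseg : ∀ a b, segment ℝ a b ⊆ Ω → ‖u a - u b‖ ≤ M * dist a b := by
    intro a b hab
    have := (convex_segment a b).norm_image_sub_le_of_norm_fderiv_le (𝕜 := ℝ) (f := u) (C := M)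
      (fun x hx => hud x (hab hx)) (fun x hx => hM x (hab hx))
      (right_mem_segment ℝ a b) (left_mem_segment ℝ a b)
    simpa [dist_eq_norm] using this
  have hc := G.cpos
  have hr := G.rpos
  set A := 1 / c
  have hA : 0 < A := by positivity
  set r2 := r / (2 * (A + 1)) with hr2
  have hr2p : 0 < r2 := by positivity
  have hAr2 : (A + 1) * r2 = r / 2 := by rw [hr2]; field_simp
  refine ⟨M * (2 * A + 1) + 2 * S / r2, by positivity, ?_⟩
  intro x hx y hy
  have hd0 : 0 ≤ dist x y := dist_nonneg
  by_cases hfar : r2 < dist x y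
  · have h1 : ‖u x - u y‖ ≤ 2 * S := (norm_sub_le _ _).trans (by linarith [hS x hx, hS y hy])
    have h2 : 2 * S ≤ 2 * S / r2 * dist x y := by
      rw [div_mul_eq_mul_div, le_div_iff₀ hr2p]; nlinarith
    have : 0 ≤ M * (2 * A + 1) * dist x y := by positivity
    linarith
  push Not at hfar
  have key : ‖u x - u y‖ ≤ M * (2 * A + 1) * dist x y := by
    by_cases hnear : dist y x < d x
    · have h1 := hseg x y (fun z hz => by
        refine G.mem_of_dist hx ?_
        have : z ∈ ball x (d x) := (convex_ball x (d x)).segment_subset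
          (mem_ball_self ((G.mem x).1 hx)) (mem_ball.2 hnear) hz
        exact mem_ball.1 this)
      have : 0 ≤ M * (2 * A) * dist x y := by positivity
      linarith
    push Not at hnear
    rw [dist_comm] at hnear
    have hr2r : r2 ≤ r / 2 := by rw [← hAr2]; nlinarith
    obtain ⟨v, hv, hdir⟩ := G.dir x hx (by linarith)
    set t := A * dist x y with ht
    have ht0 : 0 ≤ t := by positivity
    have htr : t + dist x y ≤ r / 2 := by rw [← hAr2, ht]; nlinarith
    have hdist : ∀ z τ, 0 ≤ τ → τ ≤ t → dist z x ≤ dist x y → dist (z + τ • v) x ≤ r := by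
      intro z τ h0 h1 h2
      have : dist (z + τ • v) z ≤ τ := by
        simp only [dist_self_add_left, norm_smul, Real.norm_of_nonneg h0]; nlinarith
      linarith [dist_triangle (z + τ • v) z x]
    have hup : ∀ z, z ∈ Ω → dist z x ≤ dist x y → segment ℝ z (z + t • v) ⊆ Ω := by
      intro z hz hzd w hw
      rw [segment_eq_image'] at hw
      obtain ⟨θ, ⟨h0, h1⟩, rfl⟩ := hw
      simp only [add_sub_cancel_left, smul_smul]
      have h2 : θ * t ≤ t := by nlinarith
      have h3 := hdir z (θ * t) (by simpa using hdist z 0 le_rfl ht0 hzd) (by positivity)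
        (hdist z _ (by positivity) h2 hzd)
      rw [G.mem] at hz ⊢
      have : 0 ≤ c * (θ * t) := by positivity
      linarith
    have h1 := hseg _ _ (hup x hx (by simp))
    have h2 := hseg _ _ (hup y hy (by rw [dist_comm]))
    have h3 := hseg (x + t • v) (y + t • v) (fun w hw => by
      rw [segment_eq_image'] at hw
      obtain ⟨θ, ⟨h0, h1⟩, rfl⟩ := hw
      have hxv := hdir x t (by simpa using hr.le) ht0 (hdist x t ht0 le_rfl (by simp))
      have hyx : dist y x ≤ dist x y := by rw [dist_comm]
      have e1 : x + t • v + θ • (y + t • v - (x + t • v)) = (x + θ • (y - x)) + t • v := by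
        module
      have e2 : dist (x + θ • (y - x)) x ≤ dist x y := by
        rw [dist_self_add_left, norm_smul, Real.norm_of_nonneg h0, ← dist_eq_norm, dist_comm y x]
        nlinarith
      have e3 : dist (x + t • v) (x + t • v + θ • (y + t • v - (x + t • v))) ≤ dist x y := by
        rw [e1, dist_add_right, dist_comm]
        exact e2
      have h4 := G.lip x hx (x + t • v) (x + t • v + θ • (y + t • v - (x + t • v)))
        ((hdist x t ht0 le_rfl (by simp)).trans G.rle)
        (by rw [e1]; exact (hdist _ t ht0 le_rfl e2).trans G.rle)
      rw [G.mem] at hx ⊢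
      have h5 := (abs_le.1 h4).2
      have h6 : c * t = dist x y := by simp only [ht, A]; field_simp
      linarith)
    have hdv : ∀ z, dist z (z + t • v) ≤ t := by
      intro z
      simp only [dist_self_add_right, norm_smul, Real.norm_of_nonneg ht0]; nlinarith
    have h4 : ‖u x - u y‖ ≤ ‖u x - u (x + t • v)‖ + ‖u (x + t • v) - u (y + t • v)‖
        + ‖u y - u (y + t • v)‖ := by
      have : u x - u y = (u x - u (x + t • v)) + (u (x + t • v) - u (y + t • v))
        - (u y - u (y + t • v)) := by abel
      rw [this]
      exact (norm_sub_le _ _).trans (by gcongr; exact norm_add_le _ _)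
    rw [dist_add_right] at h3
    have h5 : M * dist x (x + t • v) ≤ M * t := by gcongr; exact hdv x
    have h6 : M * dist y (y + t • v) ≤ M * t := by gcongr; exact hdv y
    calc _ ≤ M * t + M * dist x y + M * t := by linarith
      _ = _ := by simp only [ht]; ring
  have : 0 ≤ 2 * S / r2 * dist x y := by positivity
  linarith

theorem Geom.layer {n : ℕ}
    {Ω : Set (Euc n)} {d : Euc n → ℝ} {c r : ℝ} (G : Geom n Ω d c r) :
    ∃ K m r1 : ℝ, 0 < K ∧ 0 < m ∧ 0 < r1 ∧ ∀ x ∈ Ω, d x < r1 → ∀ l : ℝ, 0 < l → l ≤ 1 →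
      ENNReal.ofReal (m * l * d x ^ n) ≤
        volume {y | y ∈ Ω ∧ dist x y ≤ K * d x ∧ d y ≤ l * d x} := by
  have hc := G.cpos
  have hr := G.rpos
  set K := 2 / c + 2 with hK
  have hKp : 0 < K := by positivity
  have hK2 : 2 ≤ K := by have : 0 < 2 / c := by positivity
                         linarith
  set ω := (volume (ball (0 : Euc n) 1)).toReal with hω
  have hωp : 0 < ω := ENNReal.toReal_pos (measure_ball_pos _ _ one_pos).ne' measure_ball_lt_top.ne
  refine ⟨K, ω * (1/2)^n / (2 / c + 2), r / K, hKp, by positivity, by positivity, ?_⟩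
  intro x hx hdx l hl hl1
  have hd0 : 0 < d x := (G.mem x).1 hx
  have hKd : K * d x < r := by rwa [lt_div_iff₀' hKp] at hdx
  have hdr : d x < r := by nlinarith
  obtain ⟨v, hv, hdir⟩ := G.dir x hx hdr
  set J := ⌈2 / (c * l)⌉₊ with hJ
  have hJ1 : 2 / (c * l) ≤ J := Nat.le_ceil _
  have hJ2 : (J : ℝ) < 2 / (c * l) + 1 := Nat.ceil_lt_add_one (by positivity)
  set h := l * d x with hh
  have hh0 : 0 < h := by positivity
  set As : Set (Euc n) := {y | y ∈ Ω ∧ dist x y ≤ K * d x ∧ d y ≤ l * d x} with hAs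
  have hJh : (J : ℝ) * h ≤ (K - 1) * d x := by
    have e : (2 / (c * l) + 1) * h = (2 / c) * d x + l * d x := by
      rw [hh]; field_simp
    have : (J : ℝ) * h ≤ (2 / (c * l) + 1) * h := by gcongr
    rw [e] at this
    simp only [hK]; nlinarith
  have hcov : ball x (d x / 2) ⊆ ⋃ j ∈ Finset.range (J + 1), (fun z => z - ((j : ℝ) * h) • v) ⁻¹' As := by
    intro z hz
    rw [mem_ball] at hz
    have hd : ∀ j : ℕ, j ≤ J → dist (z - ((j : ℝ) * h) • v) x ≤ K * d x := by
      intro j hj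
      have h1 : ((j : ℝ) * h) ≤ J * h := by gcongr
      have : dist (z - ((j : ℝ) * h) • v) z ≤ (j : ℝ) * h := by
        simp only [dist_self_sub_left, norm_smul]
        rw [Real.norm_of_nonneg (by positivity)]
        have : 0 ≤ (j : ℝ) * h := by positivity
        nlinarith
      linarith [dist_triangle (z - ((j : ℝ) * h) • v) z x]
    have hex : ∃ j : ℕ, d (z - ((j : ℝ) * h) • v) ≤ h ∧ j ≤ J := by
      refine ⟨J, ?_, le_rfl⟩
      have h1 := hdir (z - ((J : ℝ) * h) • v) (J * h) ((hd J le_rfl).trans hKd.le) (by positivity)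
        (by rw [sub_add_cancel]; linarith)
      rw [sub_add_cancel] at h1
      have h2 := (abs_le.1 (G.lip x hx z x (by linarith [G.rle]) (by simp))).2
      have h3 : 2 * d x ≤ c * (J * h) := by
        have : c * ((2 / (c * l)) * h) = 2 * d x := by rw [hh]; field_simp
        rw [← this]; gcongr
      linarith
    classical
    set j := Nat.find hex with hj
    obtain ⟨hj1, hj2⟩ := Nat.find_spec hex
    simp only [Set.mem_iUnion, Finset.mem_range]
    refine ⟨j, by omega, ?_⟩
    refine ⟨?_, by rw [dist_comm]; exact hd j hj2, hj1⟩
    rcases Nat.eq_zero_or_pos j with h0 | h0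
    · rw [h0]; simp only [Nat.cast_zero, zero_mul, zero_smul, sub_zero]
      exact G.mem_of_dist hx (by linarith)
    · have hm := Nat.find_min hex (m := j - 1) (by omega)
      have : h < d (z - (((j - 1 : ℕ) : ℝ) * h) • v) := by
        by_contra hcon
        exact hm ⟨not_lt.1 hcon, by omega⟩
      have h4 := G.lip x hx (z - (((j - 1 : ℕ) : ℝ) * h) • v) (z - ((j : ℝ) * h) • v)
        (((hd (j-1) (by omega)).trans hKd.le).trans G.rle) (((hd j hj2).trans hKd.le).trans G.rle)
      have e : dist (z - (((j - 1 : ℕ) : ℝ) * h) • v) (z - ((j : ℝ) * h) • v) ≤ h := by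
        rw [dist_eq_norm]
        have : z - (((j - 1 : ℕ) : ℝ) * h) • v - (z - ((j : ℝ) * h) • v) = h • v := by
          rw [Nat.cast_sub (by omega)]; push_cast; module
        rw [this, norm_smul, Real.norm_of_nonneg hh0.le]; nlinarith
      rw [G.mem]
      have := (abs_le.1 h4).2
      linarith
  have hvol : volume (ball x (d x / 2)) ≤ (J + 1 : ℕ) * volume As := by
    refine (measure_mono hcov).trans ((measure_biUnion_finset_le _ _).trans ?_)
    have : ∀ j ∈ Finset.range (J+1), volume ((fun z => z - ((j : ℝ) * h) • v) ⁻¹' As) = volume As := by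
      intro j _
      simp only [sub_eq_add_neg]
      exact measure_preimage_add_right _ _ _
    rw [Finset.sum_congr rfl this]
    simp
  rw [Measure.addHaar_ball_of_pos _ _ (by positivity)] at hvol
  have hω2 : volume (ball (0 : Euc n) 1) = ENNReal.ofReal ω :=
    (ENNReal.ofReal_toReal measure_ball_lt_top.ne).symm
  have hJ3 : ((J + 1 : ℕ) : ℝ) ≤ (2 / c + 2) / l := by
    have : (2 / c + 2) / l = 2 / (c * l) + 2 / l := by field_simp
    rw [this]; push_cast
    have : 2 ≤ 2 / l := by rw [le_div_iff₀ hl]; linarith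
    linarith
  have hJp : (0 : ℝ) < ((J + 1 : ℕ) : ℝ) := by positivity
  rw [hω2, ← ENNReal.ofReal_mul (by positivity)] at hvol
  have hf : (Module.finrank ℝ (Euc n)) = n := by simp
  rw [hf] at hvol
  have h5 : ENNReal.ofReal ((d x / 2)^n * ω / ((J + 1 : ℕ) : ℝ)) ≤ volume As := by
    rw [ENNReal.ofReal_div_of_pos hJp, ENNReal.ofReal_natCast]
    exact ENNReal.div_le_of_le_mul' hvol
  refine le_trans (ENNReal.ofReal_le_ofReal ?_) h5
  calc _ = (d x / 2)^n * ω / ((2 / c + 2) / l) := by rw [div_pow, div_pow, one_pow]; field_simp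
    _ ≤ _ := by gcongr

/-- A fixed bump function. -/
def bump0 (n : ℕ) : ContDiffBump (0 : Euc n) := ⟨1 / 2, 1, by norm_num, by norm_num⟩

/-- The standard mollifier. -/
def rho (n : ℕ) : Euc n → ℝ := (bump0 n).normed volume

/-- The rescaled mollifier. -/
def kern (n : ℕ) (t : ℝ) (z : Euc n) : ℝ := t⁻¹ ^ n * rho n (t⁻¹ • z)

/-- The mollification of `g`, as a function of scale and position. -/
def moll (n : ℕ) (g : Euc n → ℝ) (q : ℝ × Euc n) : ℝ :=
  convolution g (kern n q.1) (ContinuousLinearMap.mul ℝ ℝ) volume q.2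

theorem rho_contDiff (n : ℕ) : ContDiff ℝ (⊤ : ℕ∞) (rho n) := (bump0 n).contDiff_normed

theorem rho_zero {n : ℕ} {z : Euc n} (h : 1 ≤ ‖z‖) : rho n z = 0 := by
  have : z ∉ Function.support (rho n) := by
    rw [rho, ContDiffBump.support_normed_eq]
    simpa [bump0] using h
  simpa using this

theorem rho_integral (n : ℕ) : ∫ z, rho n z = 1 := (bump0 n).integral_normed

theorem kern_contDiffOn (n : ℕ) :
    ContDiffOn ℝ (⊤ : ℕ∞) (Function.uncurry (kern n)) (Set.Ioi 0 ×ˢ Set.univ) := by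
  have h1 : ContDiffOn ℝ (⊤ : ℕ∞) (fun q : ℝ × Euc n => q.1⁻¹) (Set.Ioi 0 ×ˢ Set.univ) :=
    contDiffOn_fst.inv (fun q hq => (ne_of_gt hq.1))
  exact (h1.pow n).mul ((rho_contDiff n).comp_contDiffOn (h1.smul contDiffOn_snd))

theorem kern_zero {n : ℕ} {t : ℝ} (ht : 0 < t) {z : Euc n} (h : t ≤ ‖z‖) : kern n t z = 0 := by
  rw [kern, rho_zero, mul_zero]
  rw [norm_smul, norm_inv, Real.norm_of_nonneg ht.le, le_inv_mul_iff₀ ht]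
  simpa using h

theorem isOpen_half (n : ℕ) : IsOpen (Set.Ioi (0:ℝ) ×ˢ (Set.univ : Set (Euc n))) :=
  isOpen_Ioi.prod isOpen_univ

theorem fderiv_kern_zero {n : ℕ} {t : ℝ} (ht : 0 < t) {z : Euc n} (h : t < ‖z‖) :
    fderiv ℝ (Function.uncurry (kern n)) (t, z) = 0 := by
  have : Function.uncurry (kern n) =ᶠ[𝓝 (t, z)] fun _ => 0 := by
    have h1 : ∀ᶠ q : ℝ × Euc n in 𝓝 (t, z), 0 < q.1 :=
      continuous_fst.continuousAt.eventually_const_lt ht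
    have h2 : ∀ᶠ q : ℝ × Euc n in 𝓝 (t, z), q.1 < ‖q.2‖ :=
      continuous_fst.continuousAt.eventually_lt continuous_snd.norm.continuousAt h
    filter_upwards [h1, h2] with q hq1 hq2
    exact kern_zero hq1 hq2.le
  rw [this.fderiv_eq]; simp

theorem fderiv_kern_scale {n : ℕ} {t : ℝ} (ht : 0 < t) (z : Euc n) :
    ‖fderiv ℝ (Function.uncurry (kern n)) (t, z)‖ =
      t⁻¹ ^ (n + 1) * ‖fderiv ℝ (Function.uncurry (kern n)) (1, t⁻¹ • z)‖ := by
  have hfun : (Function.uncurry (kern n)) =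
      fun q => t⁻¹ ^ n * (Function.uncurry (kern n)) (t⁻¹ • q) := by
    funext ⟨s, y⟩
    simp only [Function.uncurry, kern, Prod.smul_mk, smul_eq_mul, smul_smul]
    rw [← mul_assoc, ← mul_pow]
    have : (t⁻¹ * s)⁻¹ = t * s⁻¹ := by rw [mul_inv, inv_inv]
    rw [this, ← mul_assoc, inv_mul_cancel₀ ht.ne', one_mul]
    congr 3
    field_simp
  have hd : DifferentiableAt ℝ (Function.uncurry (kern n)) (1, t⁻¹ • z) :=
    ((kern_contDiffOn n).contDiffAt ((isOpen_half n).mem_nhds ⟨by simp, trivial⟩)).differentiableAt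
      (by simp)
  have h1 : HasFDerivAt (fun q : ℝ × Euc n => t⁻¹ • q)
      (t⁻¹ • ContinuousLinearMap.id ℝ (ℝ × Euc n)) (t, z) :=
    (t⁻¹ • ContinuousLinearMap.id ℝ (ℝ × Euc n)).hasFDerivAt
  have e : t⁻¹ • (t, z) = (1, t⁻¹ • z) := by
    ext <;> simp [ht.ne']
  have h2 := (HasFDerivAt.comp (t, z) (g := Function.uncurry (kern n)) (by
    rw [e]; exact hd.hasFDerivAt) h1).const_mul (t⁻¹ ^ n)
  have h3 : HasFDerivAt (Function.uncurry (kern n)) (t⁻¹ ^ n • (fderiv ℝ (Function.uncurry (kern n)) (1, t⁻¹ • z)).comp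
      (t⁻¹ • ContinuousLinearMap.id ℝ (ℝ × Euc n))) (t, z) := by
    rw [hfun]
    convert! h2 using 1
    rw [← hfun]
  rw [h3.fderiv, norm_smul, ContinuousLinearMap.comp_smul, norm_smul, ContinuousLinearMap.comp_id]
  rw [norm_pow, norm_inv, Real.norm_of_nonneg ht.le, pow_succ, mul_assoc]

theorem fderiv_kern_bound (n : ℕ) : ∃ C : ℝ, 0 < C ∧ ∀ t > 0, ∀ z : Euc n,
    ‖fderiv ℝ (Function.uncurry (kern n)) (t, z)‖ ≤ C * t⁻¹ ^ (n + 1) := by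
  have hc : ContinuousOn (fun z : Euc n => fderiv ℝ (Function.uncurry (kern n)) (1, z))
      (closedBall 0 1) := by
    have := (kern_contDiffOn n).continuousOn_fderiv_of_isOpen (isOpen_half n) (by simp)
    exact this.comp (by fun_prop) (fun z _ => ⟨by simp, trivial⟩)
  obtain ⟨C, hC⟩ := (isCompact_closedBall (0 : Euc n) 1).exists_bound_of_continuousOn hc
  refine ⟨max C 1, by positivity, fun t ht z => ?_⟩
  rw [fderiv_kern_scale ht, mul_comm]
  gcongr
  by_cases h : ‖t⁻¹ • z‖ ≤ 1
  · exact (hC _ (by simpa using h)).trans (le_max_left _ _)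
  · rw [fderiv_kern_zero one_pos (not_le.1 h)]; simp

theorem kern_bound (n : ℕ) : ∃ C : ℝ, 0 < C ∧ ∀ t > 0, ∀ z : Euc n,
    ‖kern n t z‖ ≤ C * t⁻¹ ^ n := by
  obtain ⟨C, hC⟩ := (isCompact_closedBall (0 : Euc n) 1).exists_bound_of_continuousOn
    (rho_contDiff n).continuous.continuousOn
  refine ⟨max C 1, by positivity, fun t ht z => ?_⟩
  rw [kern, norm_mul, norm_pow, norm_inv, Real.norm_of_nonneg ht.le, mul_comm]
  gcongr
  by_cases h : ‖t⁻¹ • z‖ ≤ 1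
  · exact (hC _ (by simpa using h)).trans (le_max_left _ _)
  · rw [rho_zero (not_le.1 h).le]; simp

theorem kern_integral (n : ℕ) {t : ℝ} (ht : 0 < t) : ∫ z, kern n t z = 1 := by
  simp only [kern]
  rw [integral_const_mul, Measure.integral_comp_smul, rho_integral]
  have hf : (Module.finrank ℝ (Euc n)) = n := by simp
  rw [hf]
  have : |(t⁻¹ ^ n)⁻¹| = t ^ n := by
    rw [abs_of_pos (by positivity)]; simp
  rw [this]
  simp [ht.ne']

theorem kern_continuous (n : ℕ) (t : ℝ) : Continuous (kern n t) := by
  unfold kern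
  have := (rho_contDiff n).continuous
  fun_prop

theorem kern_compact {n : ℕ} {t : ℝ} (ht : 0 < t) : HasCompactSupport (kern n t) := by
  refine HasCompactSupport.intro (isCompact_closedBall (0 : Euc n) t) (fun z hz => ?_)
  apply kern_zero ht
  simp at hz; exact hz.le

theorem moll_convExists {n : ℕ} {g : Euc n → ℝ} (hg : LocallyIntegrable g) {t : ℝ} (ht : 0 < t) :
    ConvolutionExists g (kern n t) (ContinuousLinearMap.mul ℝ ℝ) :=
  (kern_compact ht).convolutionExists_right _ hg (kern_continuous n t)

theorem moll_sub {n : ℕ} {g h : Euc n → ℝ} (hg : LocallyIntegrable g) (hh : LocallyIntegrable h)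
    {q : ℝ × Euc n} (hq : 0 < q.1) : moll n (fun y => g y - h y) q = moll n g q - moll n h q := by
  have h1 := (moll_convExists hg hq) q.2
  have h2 := (moll_convExists hh hq) q.2
  simp only [moll, convolution]
  rw [← integral_sub h1 h2]
  congr 1; funext y; simp [sub_mul]

theorem moll_const {n : ℕ} (c : ℝ) {q : ℝ × Euc n} (hq : 0 < q.1) :
    moll n (fun _ => c) q = c := by
  simp only [moll, convolution, ContinuousLinearMap.mul_apply']
  rw [integral_const_mul, integral_sub_left_eq_self (kern n q.1), kern_integral n hq, mul_one]

theorem moll_contDiffOn {n : ℕ} {g : Euc n → ℝ} (hg : LocallyIntegrable g) :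
    ContDiffOn ℝ (⊤ : ℕ∞) (moll n g) (Set.Ioi 0 ×ˢ Set.univ) := by
  intro q hq
  have := contDiffOn_convolution_right_with_param (μ := volume) (f := g) (g := kern n)
    (n := (⊤ : ℕ∞)) (ContinuousLinearMap.mul ℝ ℝ) (s := Set.Ioo 0 (q.1 + 1)) isOpen_Ioo
    (isCompact_closedBall (0 : Euc n) (q.1 + 1)) (fun p x hp hx => by
      apply kern_zero hp.1
      simp at hx; linarith [hp.2]) hg
    ((kern_contDiffOn n).mono (Set.prod_mono Set.Ioo_subset_Ioi_self le_rfl))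
  have h2 := this.contDiffAt (x := q)
    ((isOpen_Ioo.prod isOpen_univ).mem_nhds ⟨⟨hq.1, by simp⟩, trivial⟩)
  exact h2.contDiffWithinAt

theorem moll_fderiv {n : ℕ} {g : Euc n → ℝ} (hg : LocallyIntegrable g) {t : ℝ} (ht : 0 < t)
    (x : Euc n) : fderiv ℝ (moll n g) (t, x) =
      ∫ y, g y • fderiv ℝ (Function.uncurry (kern n)) (t, x - y) := by
  have := hasFDerivAt_convolution_right_with_param (μ := volume) (f := g) (g := kern n)
    (ContinuousLinearMap.mul ℝ ℝ) (s := Set.Ioo 0 (t + 1)) isOpen_Ioo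
    (isCompact_closedBall (0 : Euc n) (t + 1)) (fun p x hp hx => by
      apply kern_zero hp.1
      simp at hx; linarith [hp.2]) hg
    (((kern_contDiffOn n).mono (Set.prod_mono Set.Ioo_subset_Ioi_self le_rfl)).of_le (by simp)) (t, x)
    ⟨ht, by simp⟩
  exact this.fderiv

theorem moll_differentiableAt {n : ℕ} {g : Euc n → ℝ} (hg : LocallyIntegrable g)
    {q : ℝ × Euc n} (hq : 0 < q.1) : DifferentiableAt ℝ (moll n g) q :=
  ((moll_contDiffOn hg).contDiffAt ((isOpen_half n).mem_nhds ⟨hq, trivial⟩)).differentiableAt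
      (by simp)

theorem fderiv_moll_sub {n : ℕ} {g h : Euc n → ℝ} (hg : LocallyIntegrable g)
    (hh : LocallyIntegrable h) {q : ℝ × Euc n} (hq : 0 < q.1) :
    fderiv ℝ (moll n (fun y => g y - h y)) q = fderiv ℝ (moll n g) q - fderiv ℝ (moll n h) q := by
  have : moll n (fun y => g y - h y) =ᶠ[𝓝 q] fun p => moll n g p - moll n h p := by
    filter_upwards [(isOpen_half n).mem_nhds ⟨hq, trivial⟩] with p hp
    exact moll_sub hg hh hp.1
  rw [this.fderiv_eq]
  exact fderiv_sub (moll_differentiableAt hg hq) (moll_differentiableAt hh hq)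

theorem fderiv_moll_const {n : ℕ} (c : ℝ) {q : ℝ × Euc n} (hq : 0 < q.1) :
    fderiv ℝ (moll n (fun _ => c)) q = 0 := by
  have : moll n (fun _ => c) =ᶠ[𝓝 q] fun p => c := by
    filter_upwards [(isOpen_half n).mem_nhds ⟨hq, trivial⟩] with p hp
    exact moll_const c hp.1
  rw [this.fderiv_eq]
  simp

/-- The key pointwise bound on the derivative of the mollification. -/
theorem moll_fderiv_bound (n : ℕ) : ∃ C : ℝ, 0 < C ∧ ∀ (g : Euc n → ℝ), LocallyIntegrable g →
    ∀ t > 0, ∀ (x : Euc n) (c : ℝ), ‖fderiv ℝ (moll n g) (t, x)‖ ≤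
      C * t⁻¹ ^ (n + 1) * ∫ y in closedBall x t, |g y - c| := by
  obtain ⟨C, hC, hb⟩ := fderiv_kern_bound n
  refine ⟨C, hC, fun g hg t ht x c => ?_⟩
  have hgc : LocallyIntegrable (fun y => g y - c) := hg.sub (locallyIntegrable_const c)
  have h1 : fderiv ℝ (moll n g) (t, x) = fderiv ℝ (moll n (fun y => g y - c)) (t, x) := by
    rw [fderiv_moll_sub hg (locallyIntegrable_const c) (by exact ht),
      fderiv_moll_const _ (by exact ht), sub_zero]
  rw [h1, moll_fderiv hgc ht, ← setIntegral_eq_integral_of_forall_compl_eq_zero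
    (s := closedBall x t) (fun y hy => by
      rw [fderiv_kern_zero ht (by simpa [dist_eq_norm, norm_sub_rev] using hy), smul_zero]),
    ← integral_const_mul]
  refine norm_integral_le_of_norm_le ?_ ?_
  · exact ((hgc.integrableOn_isCompact (isCompact_closedBall x t)).abs).const_mul _
  · refine ae_of_all _ fun y => ?_
    rw [norm_smul, mul_comm, Real.norm_eq_abs]
    gcongr
    exact hb t ht _

theorem moll_bound (n : ℕ) : ∃ C : ℝ, 0 < C ∧ ∀ (g : Euc n → ℝ), LocallyIntegrable g →
    ∀ t > 0, ∀ (x : Euc n) (c : ℝ), |moll n g (t, x) - c| ≤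
      C * t⁻¹ ^ n * ∫ y in closedBall x t, |g y - c| := by
  obtain ⟨C, hC, hb⟩ := kern_bound n
  refine ⟨C, hC, fun g hg t ht x c => ?_⟩
  have hgc : LocallyIntegrable (fun y => g y - c) := hg.sub (locallyIntegrable_const c)
  have h1 : moll n g (t, x) - c = moll n (fun y => g y - c) (t, x) := by
    rw [moll_sub hg (locallyIntegrable_const c) (by exact ht), moll_const _ (by exact ht)]
  rw [h1, moll, convolution, ← setIntegral_eq_integral_of_forall_compl_eq_zero
    (s := closedBall x t) (fun y hy => by
      simp only [ContinuousLinearMap.mul_apply']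
      rw [kern_zero ht, mul_zero]
      simp [dist_eq_norm, norm_sub_rev] at hy
      exact hy.le),
    ← integral_const_mul, ← Real.norm_eq_abs]
  refine norm_integral_le_of_norm_le ?_ ?_
  · exact ((hgc.integrableOn_isCompact (isCompact_closedBall x t)).abs).const_mul _
  · refine ae_of_all _ fun y => ?_
    simp only [ContinuousLinearMap.mul_apply']
    rw [norm_mul, mul_comm, Real.norm_eq_abs (_ - _)]
    gcongr
    exact hb t ht _

theorem fderiv_moll_linear {n : ℕ} (l : Euc n →L[ℝ] ℝ) {t : ℝ} (ht : 0 < t) (x e : Euc n) :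
    fderiv ℝ (moll n l) (t, x) (0, e) = l e := by
  have hli : LocallyIntegrable l := l.continuous.locallyIntegrable
  have hform : ∀ y, moll n l (t, y) = l y - ∫ z, kern n t z * l z := by
    intro y
    have e1 : moll n l (t, y) = ∫ z, kern n t z * l (y - z) := by
      simp only [moll, convolution, ContinuousLinearMap.mul_apply']
      rw [← integral_sub_left_eq_self (fun z => kern n t z * l (y - z)) volume y]
      congr 1; funext z; rw [sub_sub_cancel, mul_comm]
    have i1 : Integrable (fun z => kern n t z * l y) :=
      ((kern_continuous n t).integrable_of_hasCompactSupport (kern_compact ht)).mul_const _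
    have i2 : Integrable (fun z => kern n t z * l z) :=
      ((kern_continuous n t).mul l.continuous).integrable_of_hasCompactSupport
        ((kern_compact ht).mul_right)
    rw [e1]
    simp only [map_sub, mul_sub]
    rw [integral_sub i1 i2, integral_mul_const, kern_integral n ht, one_mul]
  have hd : HasFDerivAt (fun y : Euc n => moll n l (t, y))
      ((fderiv ℝ (moll n l) (t, x)).comp (ContinuousLinearMap.inr ℝ ℝ (Euc n))) x :=
    HasFDerivAt.comp x (moll_differentiableAt hli (by exact ht)).hasFDerivAt
      (hasFDerivAt_prodMk_right t x)
  have hd2 : HasFDerivAt (fun y : Euc n => moll n l (t, y)) l x := by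
    simp only [hform]
    exact l.hasFDerivAt.sub_const _
  have := hd.unique hd2
  have h3 := congrArg (fun L => L e) this
  simpa using h3

theorem volume_closedBall_real {n : ℕ} (x : Euc n) {t : ℝ} (ht : 0 < t) :
    (volume (closedBall x t)).toReal = t ^ n * ballVol n := by
  rw [Measure.addHaar_closedBall _ _ ht.le, ENNReal.toReal_mul, ENNReal.toReal_ofReal (by positivity)]
  simp [ballVol]

theorem moll_tendsto {n : ℕ} {g : Euc n → ℝ} (hg : LocallyIntegrable g) {x : Euc n}
    (hc : ContinuousAt g x) : Tendsto (fun t => moll n g (t, x)) (𝓝[>] 0) (𝓝 (g x)) := by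
  obtain ⟨C, hC, hb⟩ := moll_bound n
  rw [Metric.tendsto_nhds]
  intro ε hε
  set V := ballVol n with hV
  have hV0 : 0 ≤ V := ENNReal.toReal_nonneg
  set η := ε / (2 * (C * (V + 1))) with hη
  have hηp : 0 < η := by positivity
  obtain ⟨r, hr, hrb⟩ := Metric.continuousAt_iff.1 hc η hηp
  filter_upwards [Ioo_mem_nhdsGT hr] with t ht
  rw [Real.dist_eq]
  have h2 : ∫ y in closedBall x t, |g y - g x| ≤ η * (t ^ n * V) := by
    rw [← volume_closedBall_real x ht.1]
    refine (Real.le_norm_self _).trans (norm_setIntegral_le_of_norm_le_const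
      measure_closedBall_lt_top ?_)
    intro y hy
    have := hrb (lt_of_le_of_lt (mem_closedBall.1 hy) ht.2)
    rw [Real.dist_eq] at this
    simpa using this.le
  have h3 := hb g hg t ht.1 x (g x)
  have htp := ht.1
  calc _ ≤ _ := h3
    _ ≤ C * t⁻¹ ^ n * (η * (t ^ n * V)) := by gcongr
    _ = C * η * V := by rw [inv_pow]; field_simp
    _ ≤ C * η * (V + 1) := by gcongr; linarith
    _ = ε / 2 := by rw [hη]; field_simp
    _ < ε := by linarith

theorem fderiv_moll_tendsto {n : ℕ} {g : Euc n → ℝ} (hg : LocallyIntegrable g) {x : Euc n}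
    {l : Euc n →L[ℝ] ℝ} (hd : HasFDerivAt g l x) (e : Euc n) :
    Tendsto (fun t => fderiv ℝ (moll n g) (t, x) (0, e)) (𝓝[>] 0) (𝓝 (l e)) := by
  obtain ⟨C, hC, hb⟩ := moll_fderiv_bound n
  have hli : LocallyIntegrable l := l.continuous.locallyIntegrable
  rw [Metric.tendsto_nhds]
  intro ε hε
  set V := ballVol n with hV
  have hV0 : 0 ≤ V := ENNReal.toReal_nonneg
  set η := ε / (2 * (C * (V + 1) * (‖e‖ + 1))) with hη
  have hηp : 0 < η := by positivity
  have h0 := hd.isLittleO.def hηp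
  obtain ⟨r, hr, hrb⟩ := Metric.eventually_nhds_iff.1 h0
  filter_upwards [Ioo_mem_nhdsGT hr] with t ht
  have htp := ht.1
  have h2 : ∫ y in closedBall x t, |(g y - l y) - (g x - l x)| ≤ (η * t) * (t ^ n * V) := by
    rw [← volume_closedBall_real x ht.1]
    refine (Real.le_norm_self _).trans (norm_setIntegral_le_of_norm_le_const
      measure_closedBall_lt_top ?_)
    intro y hy
    rw [mem_closedBall] at hy
    have := hrb (lt_of_le_of_lt hy ht.2)
    rw [← dist_eq_norm y x] at this
    have e1 : (g y - l y) - (g x - l x) = g y - g x - l (y - x) := by rw [map_sub]; ring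
    rw [e1, norm_abs_eq_norm]
    exact this.trans (by gcongr)
  have h3 := hb (fun y => g y - l y) (hg.sub hli) t ht.1 x (g x - l x)
  have e2 : fderiv ℝ (moll n g) (t, x) (0, e) - l e =
      fderiv ℝ (moll n (fun y => g y - l y)) (t, x) (0, e) := by
    rw [fderiv_moll_sub hg hli (by exact ht.1), _root_.sub_apply, fderiv_moll_linear l ht.1]
  rw [Real.dist_eq, e2, ← Real.norm_eq_abs]
  have h4 := (fderiv ℝ (moll n (fun y => g y - l y)) (t, x)).le_opNorm (0, e)
  have h5 : ‖((0 : ℝ), e)‖ ≤ ‖e‖ + 1 := by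
    rw [Prod.norm_def]; simp
  calc _ ≤ _ := h4
    _ ≤ (C * t⁻¹ ^ (n+1) * ((η * t) * (t ^ n * V))) * (‖e‖ + 1) := by
      gcongr; exact h3.trans (by gcongr)
    _ = C * η * V * (‖e‖ + 1) := by rw [inv_pow, pow_succ]; field_simp
    _ ≤ C * η * (V + 1) * (‖e‖ + 1) := by gcongr; linarith
    _ = ε / 2 := by rw [hη]; field_simp
    _ < ε := by linarith

/-- Determinant as a continuous multilinear map of the rows. -/
def detC (m : ℕ) : ContinuousMultilinearMap ℝ (fun _ : Fin m => Fin m → ℝ) ℝ :=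
  { (Matrix.detRowAlternating (R := ℝ) (n := Fin m)).toMultilinearMap with
    cont := by
      show Continuous (fun A : Matrix (Fin m) (Fin m) ℝ => A.det)
      exact Continuous.matrix_det continuous_id }

theorem detC_apply {m : ℕ} (A : Fin m → Fin m → ℝ) : detC m A = (Matrix.of A).det := rfl

theorem detC_bound {m : ℕ} (A : Fin m → Fin m → ℝ) (r : Fin m → ℝ) (h : ∀ i j, |A i j| ≤ r i) :
    |detC m A| ≤ (m.factorial : ℝ) * ∏ i, r i := by
  rw [detC_apply, Matrix.det_apply]
  refine (Finset.abs_sum_le_sum_abs _ _).trans ?_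
  have : ∀ σ : Equiv.Perm (Fin m), |Equiv.Perm.sign σ • ∏ i, Matrix.of A (σ i) i| ≤ ∏ i, r i := by
    intro σ
    rw [← Equiv.prod_comp σ r]
    have : |Equiv.Perm.sign σ • ∏ i, Matrix.of A (σ i) i| = ∏ i, |A (σ i) i| := by
      rcases Int.units_eq_one_or (Equiv.Perm.sign σ) with h | h <;> simp [h, Finset.abs_prod]
    rw [this]
    exact Finset.prod_le_prod (fun _ _ => abs_nonneg _) (fun i _ => h _ _)
  refine (Finset.sum_le_sum (fun σ _ => this σ)).trans ?_
  simp [Fintype.card_perm]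

theorem detC_update_sum {m : ℕ} (A : Fin m → Fin m → ℝ) (i : Fin m) (c : Fin m → ℝ) :
    detC m (Function.update A i c) =
      ∑ k, c k * detC m (Function.update A i (Pi.single k 1)) := by
  have e : c = ∑ k, c k • (Pi.single k 1 : Fin m → ℝ) := by
    ext l; simp [Finset.sum_apply, Pi.single_apply]
  have h := (detC m).toMultilinearMap.map_update_sum Finset.univ i
    (fun k => c k • (Pi.single k 1 : Fin m → ℝ)) A
  rw [← e] at h
  refine h.trans (Finset.sum_congr rfl fun k _ => ?_)
  exact (detC m).map_update_smul A i (c k) _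

theorem piola_alg {n : ℕ} (A : Fin (n+1) → Fin (n+1) → ℝ) (i : Fin n)
    (H : Fin (n+1) → Fin (n+1) → ℝ) (hH : ∀ j k, H j k = H k j) :
    ∑ j, detC (n+1) (Function.update (Function.update A 0 (Pi.single j 1)) i.succ (H j)) = 0 := by
  have h1 : ∀ j, detC (n+1) (Function.update (Function.update A 0 (Pi.single j 1)) i.succ (H j)) =
      ∑ k, H j k * detC (n+1) (Function.update (Function.update A 0 (Pi.single j 1)) i.succ
        (Pi.single k 1)) := by
    intro j
    exact detC_update_sum _ _ _
  have anti : ∀ j k, detC (n+1) (Function.update (Function.update A 0 (Pi.single j 1)) i.succ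
        (Pi.single k 1)) = - detC (n+1) (Function.update (Function.update A 0 (Pi.single k 1)) i.succ
        (Pi.single j 1)) := by
    intro j k
    have := (Matrix.detRowAlternating (R := ℝ) (n := Fin (n+1))).map_swap
      (Function.update (Function.update A 0 (Pi.single k 1)) i.succ (Pi.single j 1))
      (i := 0) (j := i.succ) (Fin.succ_ne_zero i).symm
    have e : (Function.update (Function.update A 0 (Pi.single k 1)) i.succ (Pi.single j 1)) ∘
        (Equiv.swap 0 i.succ) = Function.update (Function.update A 0 (Pi.single j 1)) i.succ
        (Pi.single k 1) := by
      funext l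
      by_cases hl : l = 0
      · subst hl; simp [Function.update_of_ne (Fin.succ_ne_zero i).symm]
      by_cases hl2 : l = i.succ
      · subst hl2; simp [Function.update_of_ne (Fin.succ_ne_zero i).symm]
      simp [Equiv.swap_apply_of_ne_of_ne hl hl2, Function.update_of_ne hl,
        Function.update_of_ne hl2]
    rw [e] at this
    exact this
  simp only [h1]
  have h2 : ∑ j, ∑ k, H j k * detC (n+1) (Function.update (Function.update A 0 (Pi.single j 1)) i.succ
        (Pi.single k 1)) = - ∑ j, ∑ k, H j k * detC (n+1) (Function.update (Function.update A 0 (Pi.single j 1)) i.succ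
        (Pi.single k 1)) := by
    conv_lhs => rw [Finset.sum_comm]
    rw [← Finset.sum_neg_distrib]
    refine Finset.sum_congr rfl fun k _ => ?_
    rw [← Finset.sum_neg_distrib]
    refine Finset.sum_congr rfl fun j _ => ?_
    rw [anti j k, hH j k]; ring
  linarith

/-- coordinate gradient -/
def cgrad {m : ℕ} (f : (Fin m → ℝ) → ℝ) (q : Fin m → ℝ) : Fin m → ℝ :=
  fun j => fderiv ℝ f q (Pi.single j 1)

/-- rows matrix -/
def rows {n : ℕ} (v : Fin (n+1) → ℝ) (w : Fin n → (Fin (n+1) → ℝ) → ℝ) (q : Fin (n+1) → ℝ) :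
    Fin (n+1) → Fin (n+1) → ℝ := Fin.cons v (fun i => cgrad (w i) q)

theorem cgrad_hasFDerivAt {m : ℕ} {f : (Fin m → ℝ) → ℝ} {q : Fin m → ℝ} (h : ContDiffAt ℝ 2 f q) :
    HasFDerivAt (cgrad f) (ContinuousLinearMap.pi fun j =>
      (ContinuousLinearMap.apply ℝ ℝ (Pi.single j 1 : Fin m → ℝ)).comp
        (fderiv ℝ (fderiv ℝ f) q)) q := by
  rw [hasFDerivAt_pi]
  intro j
  have h1 : DifferentiableAt ℝ (fderiv ℝ f) q :=
    (h.fderiv_right (m := 1) (by norm_num)).differentiableAt (by norm_num)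
  exact (ContinuousLinearMap.apply ℝ ℝ (Pi.single j 1 : Fin m → ℝ)).hasFDerivAt.comp q h1.hasFDerivAt

theorem rows_hasFDerivAt {n : ℕ} (v : Fin (n+1) → ℝ) {w : Fin n → (Fin (n+1) → ℝ) → ℝ}
    {q : Fin (n+1) → ℝ} (h : ∀ i, ContDiffAt ℝ 2 (w i) q) :
    ∃ R : (Fin (n+1) → ℝ) →L[ℝ] ℝ, HasFDerivAt (fun q => detC (n+1) (rows v w q)) R q ∧
      ∀ e, R e = ∑ i : Fin n, detC (n+1) (Function.update (rows v w q) i.succ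
        (fun k => fderiv ℝ (fderiv ℝ (w i)) q e (Pi.single k 1))) := by
  have h1 : HasFDerivAt (fun q => rows v w q) (ContinuousLinearMap.pi
      (Fin.cons 0 (fun i => ContinuousLinearMap.pi fun j =>
      (ContinuousLinearMap.apply ℝ ℝ (Pi.single j 1 : Fin (n+1) → ℝ)).comp
        (fderiv ℝ (fderiv ℝ (w i)) q)) : Fin (n+1) → ((Fin (n+1) → ℝ) →L[ℝ] (Fin (n+1) → ℝ)))) q := by
    rw [hasFDerivAt_pi]
    intro i
    refine Fin.cases ?_ (fun i => ?_) i
    · simpa [rows] using hasFDerivAt_const (𝕜 := ℝ) v q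
    · simpa [rows] using cgrad_hasFDerivAt (h i)
  have h2 : HasFDerivAt (fun A => detC (n+1) A) ((detC (n+1)).linearDeriv (rows v w q)) (rows v w q) :=
    (detC (n+1)).hasFDerivAt (rows v w q)
  refine ⟨_, HasFDerivAt.comp q h2 h1, fun e => ?_⟩
  rw [ContinuousLinearMap.comp_apply, ContinuousMultilinearMap.linearDeriv_apply, Fin.sum_univ_succ]
  have : detC (n+1) (Function.update (rows v w q) 0 0) = 0 :=
    (detC (n+1)).map_update_zero _ _
  simp only [ContinuousLinearMap.coe_pi', Fin.cons_zero, Fin.cons_succ, _root_.zero_apply]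
  rw [this, zero_add]
  rfl

theorem detC_row0 {n : ℕ} (A : Fin n → Fin (n+1) → ℝ) (v : Fin (n+1) → ℝ) :
    detC (n+1) (Fin.cons v A) = ∑ j, v j * detC (n+1) (Fin.cons (Pi.single j 1) A) := by
  have h : ∀ z, (Fin.cons z A : Fin (n+1) → Fin (n+1) → ℝ) = Function.update (Fin.cons 0 A) 0 z := by
    intro z; simp
  rw [h, detC_update_sum]
  simp only [← h]

theorem piola_div {n : ℕ} {w : Fin n → (Fin (n+1) → ℝ) → ℝ} {Ψ : (Fin (n+1) → ℝ) → ℝ}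
    {q : Fin (n+1) → ℝ} (h : ∀ i, ContDiffAt ℝ 2 (w i) q) (hΨ : ContDiffAt ℝ 1 Ψ q) :
    ∃ f' : Fin (n+1) → ((Fin (n+1) → ℝ) →L[ℝ] ℝ),
      (∀ j, HasFDerivAt (fun q => Ψ q * detC (n+1) (rows (Pi.single j 1) w q)) (f' j) q) ∧
      ∑ j, f' j (Pi.single j 1) = detC (n+1) (rows (cgrad Ψ q) w q) := by
  choose R hR hRe using fun j => rows_hasFDerivAt (Pi.single j 1) h
  have hd := (hΨ.differentiableAt (by norm_num)).hasFDerivAt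
  refine ⟨_, fun j => hd.mul (hR j), ?_⟩
  simp only [_root_.add_apply, _root_.smul_apply, smul_eq_mul,
    Finset.sum_add_distrib, ← Finset.mul_sum, hRe]
  have h0 : ∑ j, ∑ i : Fin n, detC (n+1) (Function.update (rows (Pi.single j 1) w q) i.succ
        (fun k => fderiv ℝ (fderiv ℝ (w i)) q (Pi.single j 1) (Pi.single k 1))) = 0 := by
    rw [Finset.sum_comm]
    refine Finset.sum_eq_zero fun i _ => ?_
    have hs := (h i).isSymmSndFDerivAt (by simp)
    have := piola_alg (rows 0 w q) i (fun j k => fderiv ℝ (fderiv ℝ (w i)) q (Pi.single j 1) (Pi.single k 1))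
      (fun j k => hs _ _)
    rw [← this]
    refine Finset.sum_congr rfl fun j _ => ?_
    simp [rows]
  rw [h0, mul_zero, zero_add, rows, detC_row0]
  refine Finset.sum_congr rfl fun j _ => ?_
  simp only [cgrad, rows]; ring

theorem piola_int {n : ℕ} {w : Fin n → (Fin (n+1) → ℝ) → ℝ} {Ψ : (Fin (n+1) → ℝ) → ℝ}
    {a b : Fin (n+1) → ℝ} (hab : a ≤ b) {U : Set (Fin (n+1) → ℝ)} (hU : IsOpen U)
    (hsub : Set.Icc a b ⊆ U)
    (hw : ∀ i, ContDiffOn ℝ 2 (w i) U) (hΨ : ContDiffOn ℝ 1 Ψ U)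
    (hb : ∀ q ∈ U, ∀ i, q i = b i → Ψ q = 0)
    (ha : ∀ q ∈ U, ∀ i : Fin n, q i.succ = a i.succ → Ψ q = 0) :
    ∫ q in Set.Icc a b, detC (n+1) (rows (cgrad Ψ q) w q) =
      - ∫ x in Set.Icc (fun i : Fin n => a i.succ) (fun i : Fin n => b i.succ),
        Ψ (Fin.cons (a 0) x) * detC (n+1) (rows (Pi.single 0 1) w (Fin.cons (a 0) x)) := by
  have hw' : ∀ q ∈ U, ∀ i, ContDiffAt ℝ 2 (w i) q := fun q hq i => (hw i).contDiffAt (hU.mem_nhds hq)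
  have hΨ' : ∀ q ∈ U, ContDiffAt ℝ 1 Ψ q := fun q hq => hΨ.contDiffAt (hU.mem_nhds hq)
  have hex : ∀ q, ∃ f' : Fin (n+1) → ((Fin (n+1) → ℝ) →L[ℝ] ℝ), q ∈ U →
      (∀ j, HasFDerivAt (fun q => Ψ q * detC (n+1) (rows (Pi.single j 1) w q)) (f' j) q) ∧
      ∑ j, f' j (Pi.single j 1) = detC (n+1) (rows (cgrad Ψ q) w q) := by
    intro q
    by_cases hq : q ∈ U
    · obtain ⟨f', h⟩ := piola_div (hw' q hq) (hΨ' q hq)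
      exact ⟨f', fun _ => h⟩
    · exact ⟨0, fun h => absurd h hq⟩
  choose f' hf' using hex
  have hgc : ∀ i, ContinuousOn (cgrad (w i)) U := fun i q hq =>
    (cgrad_hasFDerivAt (hw' q hq i)).continuousAt.continuousWithinAt
  have hgΨ : ContinuousOn (cgrad Ψ) U := by
    have := hΨ.continuousOn_fderiv_of_isOpen hU (by norm_num)
    exact continuousOn_pi.2 fun j => this.clm_apply continuousOn_const
  have hcont : ContinuousOn (fun q => detC (n+1) (rows (cgrad Ψ q) w q)) U := by
    refine (detC (n+1)).cont.comp_continuousOn (continuousOn_pi.2 fun i => ?_)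
    refine Fin.cases ?_ (fun i => ?_) i
    · simpa [rows] using hgΨ
    · simpa [rows] using hgc i
  have key := integral_divergence_of_hasFDerivAt_off_countable' a b hab
    (fun j q => Ψ q * detC (n+1) (rows (Pi.single j 1) w q)) (fun j q => f' q j) ∅ Set.countable_empty
    (fun j q hq => ((hf' q (hsub hq)).1 j).continuousAt.continuousWithinAt)
    (fun q hq j => (hf' q (hsub ⟨fun i => (hq.1 i trivial).1.le, fun i => (hq.1 i trivial).2.le⟩)).1 j)
    (by
      refine (ContinuousOn.integrableOn_compact isCompact_Icc (hcont.mono hsub)).congr_fun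
        (fun q hq => ?_) measurableSet_Icc
      exact ((hf' q (hsub hq)).2).symm)
  rw [setIntegral_congr_fun measurableSet_Icc (fun q hq => (hf' q (hsub hq)).2)] at key
  rw [key, Fin.sum_univ_succ]
  have mem : ∀ (i : Fin (n+1)) (c : ℝ), a i ≤ c → c ≤ b i → ∀ x ∈ Set.Icc (a ∘ i.succAbove) (b ∘ i.succAbove),
      i.insertNth c x ∈ U := by
    intro i c h1 h2 x hx
    exact hsub (Fin.insertNth_mem_Icc.2 ⟨⟨h1, h2⟩, hx⟩)
  have z1 : ∀ i : Fin (n+1), ∫ x in Set.Icc (a ∘ i.succAbove) (b ∘ i.succAbove),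
      Ψ (i.insertNth (b i) x) * detC (n+1) (rows (Pi.single i 1) w (i.insertNth (b i) x)) = 0 := by
    intro i
    rw [← integral_zero (Fin n → ℝ) ℝ (μ := volume.restrict (Set.Icc (a ∘ i.succAbove) (b ∘ i.succAbove)))]
    refine setIntegral_congr_fun measurableSet_Icc fun x hx => ?_
    rw [hb _ (mem i (b i) (hab i) le_rfl x hx) i (by simp), zero_mul]
  have z2 : ∀ i : Fin n, ∫ x in Set.Icc (a ∘ i.succ.succAbove) (b ∘ i.succ.succAbove),
      Ψ (i.succ.insertNth (a i.succ) x) * detC (n+1) (rows (Pi.single i.succ 1) w (i.succ.insertNth (a i.succ) x)) = 0 := by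
    intro i
    rw [← integral_zero (Fin n → ℝ) ℝ (μ := volume.restrict (Set.Icc (a ∘ i.succ.succAbove) (b ∘ i.succ.succAbove)))]
    refine setIntegral_congr_fun measurableSet_Icc fun x hx => ?_
    rw [ha _ (mem i.succ (a i.succ) le_rfl (hab _) x hx) i (by simp), zero_mul]
  simp only [z1, z2, sub_zero, Finset.sum_const_zero, add_zero, zero_sub]
  simp only [Fin.insertNth_zero']
  rfl

theorem detC_first {n : ℕ} (A : Fin n → Fin (n+1) → ℝ) :
    detC (n+1) (Fin.cons (Pi.single 0 1) A) = (Matrix.of fun i j : Fin n => A i j.succ).det := by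
  rw [detC_apply, Matrix.det_succ_row_zero, Fin.sum_univ_succ]
  simp
  rfl

/-- the identification of `ℝ^{n+1}` with `ℝ × ℝ^n`. -/
def Lmap (n : ℕ) : (Fin (n+1) → ℝ) →L[ℝ] ℝ × Euc n :=
  (ContinuousLinearMap.proj 0).prod
    ((PiLp.continuousLinearEquiv 2 ℝ (fun _ : Fin n => ℝ)).symm.toContinuousLinearMap.comp
      (ContinuousLinearMap.pi fun i => ContinuousLinearMap.proj i.succ))

theorem Lmap_apply {n : ℕ} (q : Fin (n+1) → ℝ) :
    Lmap n q = (q 0, WithLp.toLp 2 (fun i => q i.succ)) := rfl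

theorem Lmap_cons {n : ℕ} (t : ℝ) (x : Fin n → ℝ) :
    Lmap n (Fin.cons t x) = (t, WithLp.toLp 2 x) := by
  rw [Lmap_apply]; simp

theorem Lmap_single_zero (n : ℕ) : Lmap n (Pi.single 0 1) = (1, 0) := by
  rw [Lmap_apply]; ext <;> simp

theorem Lmap_single_succ {n : ℕ} (j : Fin n) :
    Lmap n (Pi.single j.succ 1) = (0, EuclideanSpace.single j 1) := by
  rw [Lmap_apply]
  ext i
  · simp
  · simp [Pi.single_apply]

theorem Lmap_norm {n : ℕ} (j : Fin (n+1)) : ‖Lmap n (Pi.single j 1)‖ ≤ 1 := by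
  refine Fin.cases ?_ (fun j => ?_) j
  · rw [Lmap_single_zero]; simp [Prod.norm_def]
  · rw [Lmap_single_succ]; simp [Prod.norm_def]

theorem Lmap_mp (n : ℕ) : MeasurePreserving (Lmap n) := by
  have h1 := volume_preserving_piFinSuccAbove (fun _ : Fin (n+1) => ℝ) 0
  have h2 : MeasurePreserving (Prod.map id (@WithLp.toLp 2 (Fin n → ℝ)))
      (volume : Measure (ℝ × (Fin n → ℝ))) (volume : Measure (ℝ × Euc n)) :=
    (MeasurePreserving.id _).prod (PiLp.volume_preserving_toLp (Fin n))
  exact h2.comp h1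

theorem Lmap_emb (n : ℕ) : MeasurableEmbedding (Lmap n) := by
  refine (Lmap n).continuous.measurableEmbedding ?_
  intro p q h
  rw [Lmap_apply, Lmap_apply, Prod.mk.injEq] at h
  funext i
  refine Fin.cases h.1 (fun i => ?_) i
  have := congrArg (fun v : Euc n => v i) h.2
  simpa using this

theorem cgrad_comp {n : ℕ} {f : ℝ × Euc n → ℝ} {q : Fin (n+1) → ℝ}
    (h : DifferentiableAt ℝ f (Lmap n q)) (j : Fin (n+1)) :
    cgrad (f ∘ Lmap n) q j = fderiv ℝ f (Lmap n q) (Lmap n (Pi.single j 1)) := by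
  have := h.hasFDerivAt.comp q (Lmap n).hasFDerivAt
  rw [cgrad, this.fderiv]; rfl

theorem piola_main {n : ℕ} {W : Fin n → ℝ × Euc n → ℝ} {Ψ : ℝ × Euc n → ℝ}
    (hW : ∀ i, ContDiffOn ℝ 2 (W i) (Set.Ioi 0 ×ˢ Set.univ))
    (hΨ : ContDiffOn ℝ 1 Ψ (Set.Ioi 0 ×ˢ Set.univ)) {R : ℝ} (hR : 0 < R)
    (h1 : ∀ t x, 1 ≤ t → Ψ (t, x) = 0) (h2 : ∀ t x, 0 < t → R ≤ ‖x‖ → Ψ (t, x) = 0)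
    {ε : ℝ} (hε : 0 < ε) (hε1 : ε ≤ 1) :
    ‖∫ x, Ψ (ε, x) * (Matrix.of fun i j => fderiv ℝ (W i) (ε, x)
      (0, EuclideanSpace.single j 1)).det‖ₑ ≤
      ((n+1).factorial : ENNReal) * ∫⁻ z in Set.Ioi 0 ×ˢ Set.univ,
        ‖fderiv ℝ Ψ z‖ₑ * ∏ i, ‖fderiv ℝ (W i) z‖ₑ := by
  set a : Fin (n+1) → ℝ := Fin.cons ε (fun _ => -R) with ha
  set b : Fin (n+1) → ℝ := Fin.cons 1 (fun _ => R) with hb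
  have hab : a ≤ b := by
    intro i
    refine Fin.cases ?_ (fun i => ?_) i
    · simpa [a, b] using hε1
    · simp [a, b]; linarith
  set U : Set (Fin (n+1) → ℝ) := {q | 0 < q 0} with hU
  have hUo : IsOpen U := isOpen_lt continuous_const (continuous_apply 0)
  have hsub : Set.Icc a b ⊆ U := fun q hq => lt_of_lt_of_le hε (by simpa [a] using hq.1 0)
  have hmaps : Set.MapsTo (Lmap n) U (Set.Ioi 0 ×ˢ Set.univ) := fun q hq => ⟨hq, trivial⟩
  have hn1 : ∀ (x : Fin n → ℝ) i, |x i| ≤ ‖(WithLp.toLp 2 x : Euc n)‖ := fun x i =>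
    PiLp.norm_apply_le (WithLp.toLp 2 x : Euc n) i
  have key := piola_int (w := fun i => W i ∘ Lmap n) (Ψ := Ψ ∘ Lmap n) hab hUo hsub
    (fun i => (hW i).comp (Lmap n).contDiff.contDiffOn hmaps)
    (hΨ.comp (Lmap n).contDiff.contDiffOn hmaps)
    (by
      intro q hq i
      refine Fin.cases (fun h => ?_) (fun i h => ?_) i
      · exact h1 _ _ (by simpa [b] using h.ge)
      · refine h2 _ _ hq (le_trans ?_ (hn1 (fun i => q i.succ) i))
        simp [b] at h
        rw [h]; exact le_abs_self R)
    (by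
      intro q hq i h
      refine h2 _ _ hq (le_trans ?_ (hn1 (fun i => q i.succ) i))
      simp [a] at h
      rw [h, abs_neg]; exact le_abs_self R)
  have hdW : ∀ i, ∀ z ∈ Set.Ioi 0 ×ˢ Set.univ, DifferentiableAt ℝ (W i) z := fun i z hz =>
    ((hW i).contDiffAt ((isOpen_half n).mem_nhds hz)).differentiableAt (by norm_num)
  have hdΨ : ∀ z ∈ Set.Ioi 0 ×ˢ Set.univ, DifferentiableAt ℝ Ψ z := fun z hz =>
    (hΨ.contDiffAt ((isOpen_half n).mem_nhds hz)).differentiableAt (by norm_num)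
  have e1 : ∫ x, Ψ (ε, x) * (Matrix.of fun i j => fderiv ℝ (W i) (ε, x)
      (0, EuclideanSpace.single j 1)).det = ∫ x in Set.Icc (fun i : Fin n => a i.succ) (fun i : Fin n => b i.succ),
        (Ψ ∘ Lmap n) (Fin.cons (a 0) x) * detC (n+1) (rows (Pi.single 0 1) (fun i => W i ∘ Lmap n) (Fin.cons (a 0) x)) := by
    have emb : MeasurableEmbedding (@WithLp.toLp 2 (Fin n → ℝ)) :=
      (MeasurableEquiv.toLp 2 (Fin n → ℝ)).measurableEmbedding
    rw [← (PiLp.volume_preserving_toLp (Fin n)).integral_comp emb]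
    rw [← setIntegral_eq_integral_of_forall_compl_eq_zero (s := Set.Icc (fun i : Fin n => a i.succ) (fun i : Fin n => b i.succ))]
    · refine setIntegral_congr_fun measurableSet_Icc fun x hx => ?_
      simp only [Function.comp_apply, Lmap_cons, rows, detC_first]
      have ea : a 0 = ε := by simp [a]
      rw [ea]
      congr 3
      funext i j
      rw [cgrad_comp, Lmap_single_succ, Lmap_cons]
      exact hdW i _ (by rw [Lmap_cons]; exact ⟨hε, trivial⟩)
    · intro x hx
      rw [h2 _ _ hε, zero_mul]
      by_contra hlt
      apply hx
      have h3 : ∀ i, |x i| ≤ R := fun i => (hn1 x i).trans (not_le.1 hlt).le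
      exact ⟨fun i => by simpa [a] using (abs_le.1 (h3 i)).1, fun i => by simpa [b] using (abs_le.1 (h3 i)).2⟩
  rw [e1]
  have e2 := neg_eq_iff_eq_neg.2 key
  rw [← e2, enorm_neg]
  refine (enorm_integral_le_lintegral_enorm _).trans ?_
  have e3 : ∀ q ∈ Set.Icc a b, ‖detC (n+1) (rows (cgrad (Ψ ∘ Lmap n) q) (fun i => W i ∘ Lmap n) q)‖ₑ ≤
      ((n+1).factorial : ENNReal) * (‖fderiv ℝ Ψ (Lmap n q)‖ₑ * ∏ i, ‖fderiv ℝ (W i) (Lmap n q)‖ₑ) := by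
    intro q hq
    have hz := hmaps (hsub hq)
    have := detC_bound (rows (cgrad (Ψ ∘ Lmap n) q) (fun i => W i ∘ Lmap n) q)
      (Fin.cons ‖fderiv ℝ Ψ (Lmap n q)‖ (fun i => ‖fderiv ℝ (W i) (Lmap n q)‖)) (by
        intro i j
        have hop : ∀ T : ℝ × Euc n →L[ℝ] ℝ, |T (Lmap n (Pi.single j 1))| ≤ ‖T‖ := fun T =>
          (T.le_opNorm _).trans (mul_le_of_le_one_right (norm_nonneg _) (Lmap_norm j))
        refine Fin.cases ?_ (fun i => ?_) i
        · simp only [rows, Fin.cons_zero]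
          rw [cgrad_comp (hdΨ _ hz)]; exact hop _
        · simp only [rows, Fin.cons_succ]
          rw [cgrad_comp (hdW i _ hz)]; exact hop _)
    rw [Fin.prod_univ_succ] at this
    simp only [Fin.cons_zero, Fin.cons_succ] at this
    rw [← Real.norm_eq_abs] at this
    have h4 := ENNReal.ofReal_le_ofReal this
    rw [ofReal_norm, ENNReal.ofReal_mul (by positivity), ENNReal.ofReal_mul (by positivity),
      ENNReal.ofReal_prod_of_nonneg (fun _ _ => norm_nonneg _), ENNReal.ofReal_natCast] at h4
    simpa only [ofReal_norm] using h4
  refine (setLIntegral_mono' measurableSet_Icc e3).trans ?_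
  rw [← (Lmap_mp n).setLIntegral_comp_preimage_emb (Lmap_emb n)]
  have e4 : Set.Icc a b ⊆ Lmap n ⁻¹' (Set.Ioi 0 ×ˢ Set.univ) := fun q hq => hmaps (hsub hq)
  refine (lintegral_mono_set e4).trans ?_
  rw [lintegral_const_mul']
  exact ENNReal.natCast_ne_top _

theorem jensen_set {n : ℕ} (hn : 1 ≤ n) {α : Type*} [MeasurableSpace α] (μ : Measure α)
    {f : α → ENNReal} (hf : AEMeasurable f μ) :
    (∫⁻ y, f y ∂μ) ^ (n+1) ≤ μ Set.univ ^ n * ∫⁻ y, f y ^ (n+1) ∂μ := by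
  have hn0 : (0:ℝ) < n := by exact_mod_cast hn
  have hpq : ((n:ℝ)+1).HolderConjugate (((n:ℝ)+1)/n) := by
    rw [Real.holderConjugate_iff]
    constructor
    · linarith
    · field_simp; ring
  have h := ENNReal.lintegral_mul_le_Lp_mul_Lq μ hpq hf (aemeasurable_const (b := (1:ENNReal)))
  simp only [Pi.mul_apply, mul_one, ENNReal.one_rpow, lintegral_const, one_mul] at h
  have h2 := pow_le_pow_left' h (n+1)
  rw [mul_pow, mul_comm] at h2
  refine h2.trans (le_of_eq ?_)
  congr 1
  · rw [← ENNReal.rpow_natCast, ← ENNReal.rpow_mul, ← ENNReal.rpow_natCast]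
    congr 1
    push_cast; field_simp
  · rw [← ENNReal.rpow_natCast, ← ENNReal.rpow_mul]
    have : (1 / ((n:ℝ)+1)) * ((n+1 : ℕ):ℝ) = 1 := by push_cast; field_simp
    rw [this, ENNReal.rpow_one]
    refine lintegral_congr fun y => ?_
    rw [← ENNReal.rpow_natCast]; push_cast; rfl

/-- the local energy -/
def Jn (n : ℕ) {F : Type*} [NormedAddCommGroup F] (g : Euc n → F) (z : ℝ × Euc n) : ENNReal :=
  ENNReal.ofReal z.1⁻¹ ^ (2*n+1) * ∫⁻ y in closedBall z.2 z.1, ‖g y - g z.2‖ₑ ^ (n+1)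

theorem moll_energy {n : ℕ} (hn : 1 ≤ n) : ∃ C : ENNReal, C ≠ ⊤ ∧ ∀ (g : Euc n → ℝ),
    LocallyIntegrable g → ∀ t > 0, ∀ x,
    ‖fderiv ℝ (moll n g) (t, x)‖ₑ ^ (n+1) ≤ C * Jn n g (t, x) ∧
    (ENNReal.ofReal t⁻¹ * ‖moll n g (t, x) - g x‖ₑ) ^ (n+1) ≤ C * Jn n g (t, x) := by
  obtain ⟨C1, hC1, h1⟩ := moll_fderiv_bound n
  obtain ⟨C2, hC2, h2⟩ := moll_bound n
  set C := max C1 C2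
  have main : ∀ (g : Euc n → ℝ), LocallyIntegrable g → ∀ t > 0, ∀ x, ∀ (X : ENNReal),
      X ≤ ENNReal.ofReal C * ENNReal.ofReal t⁻¹ ^ (n+1) * ENNReal.ofReal (∫ y in closedBall x t, |g y - g x|) →
      X ^ (n+1) ≤ (ENNReal.ofReal C ^ (n+1) * volume (ball (0 : Euc n) 1) ^ n) * Jn n g (t, x) := by
    intro g hg t ht x X hX
    have hi : IntegrableOn (fun y => g y - g x) (closedBall x t) :=
      (hg.integrableOn_isCompact (isCompact_closedBall x t)).sub
        (integrableOn_const (by exact measure_closedBall_lt_top.ne))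
    have e : ENNReal.ofReal (∫ y in closedBall x t, |g y - g x|) = ∫⁻ y in closedBall x t, ‖g y - g x‖ₑ := by
      exact ofReal_integral_norm_eq_lintegral_enorm hi
    rw [e] at hX
    have hj := jensen_set hn (volume.restrict (closedBall x t)) hi.1.enorm
    rw [Measure.restrict_apply_univ, Measure.addHaar_closedBall _ _ ht.le, finrank_euclideanSpace_fin] at hj
    have hab : ENNReal.ofReal t⁻¹ * ENNReal.ofReal t = 1 := by
      rw [← ENNReal.ofReal_mul (by positivity), inv_mul_cancel₀ ht.ne', ENNReal.ofReal_one]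
    rw [ENNReal.ofReal_pow ht.le] at hj
    set a := ENNReal.ofReal t⁻¹
    set b := ENNReal.ofReal t
    calc X ^ (n+1) ≤ _ := pow_le_pow_left' hX (n+1)
      _ = ENNReal.ofReal C ^ (n+1) * a ^ ((n+1)*(n+1)) * (∫⁻ y in closedBall x t, ‖g y - g x‖ₑ) ^ (n+1) := by
        rw [mul_pow, mul_pow, pow_mul]
      _ ≤ ENNReal.ofReal C ^ (n+1) * a ^ ((n+1)*(n+1)) * ((b ^ n * volume (ball (0 : Euc n) 1)) ^ n *
          ∫⁻ y in closedBall x t, ‖g y - g x‖ₑ ^ (n+1)) := by gcongr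
      _ = (a * b) ^ (n*n) * ((ENNReal.ofReal C ^ (n+1) * volume (ball (0 : Euc n) 1) ^ n) * (a ^ (2*n+1) *
          ∫⁻ y in closedBall x t, ‖g y - g x‖ₑ ^ (n+1))) := by ring
      _ = _ := by rw [hab, one_pow, one_mul]; rfl
  refine ⟨_, ?_, fun g hg t ht x => ⟨main g hg t ht x _ ?_, main g hg t ht x _ ?_⟩⟩
  · exact ENNReal.mul_ne_top (ENNReal.pow_ne_top ENNReal.ofReal_ne_top)
      (ENNReal.pow_ne_top measure_ball_lt_top.ne)
  · rw [← ofReal_norm, ← ENNReal.ofReal_pow (by positivity), ← ENNReal.ofReal_mul (by positivity),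
      ← ENNReal.ofReal_mul (by positivity)]
    refine ENNReal.ofReal_le_ofReal ((h1 g hg t ht x (g x)).trans ?_)
    have : 0 ≤ ∫ y in closedBall x t, |g y - g x| := integral_nonneg fun _ => abs_nonneg _
    gcongr
    exact le_max_left _ _
  · rw [← ofReal_norm, ← ENNReal.ofReal_pow (by positivity), ← ENNReal.ofReal_mul (by positivity),
      ← ENNReal.ofReal_mul (by positivity), ← ENNReal.ofReal_mul (by positivity)]
    refine ENNReal.ofReal_le_ofReal ?_
    have : 0 ≤ ∫ y in closedBall x t, |g y - g x| := integral_nonneg fun _ => abs_nonneg _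
    calc t⁻¹ * ‖moll n g (t, x) - g x‖ ≤ t⁻¹ * (C2 * t⁻¹ ^ n * ∫ y in closedBall x t, |g y - g x|) := by
          gcongr; exact h2 g hg t ht x (g x)
      _ = C2 * t⁻¹ ^ (n+1) * ∫ y in closedBall x t, |g y - g x| := by ring
      _ ≤ _ := by gcongr; exact le_max_right _ _

/-- the Gagliardo energy -/
def Sen (n : ℕ) (Ω : Set (Euc n)) {F : Type*} [NormedAddCommGroup F] (g : Euc n → F) : ENNReal :=
  ∫⁻ x in Ω, ∫⁻ y in Ω, ‖g x - g y‖ₑ ^ (n+1) * ENNReal.ofReal (dist x y)⁻¹ ^ (2*n)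

/-- the region under the graph of `d` -/
def Qset (n : ℕ) (d : Euc n → ℝ) : Set (ℝ × Euc n) := {z | 0 < z.1 ∧ z.1 < d z.2}

theorem lint_pow {r : ℝ} (hr : 0 < r) {k : ℕ} (hk : 1 ≤ k) :
    ∫⁻ t in Set.Ici r, ENNReal.ofReal t⁻¹ ^ (k+1) ≤ ENNReal.ofReal r⁻¹ ^ k := by
  rw [setLIntegral_congr Ioi_ae_eq_Ici.symm]
  have hk' : (1:ℝ) ≤ k := by exact_mod_cast hk
  have h1 : ∀ t ∈ Set.Ioi r, ENNReal.ofReal t⁻¹ ^ (k+1) = ENNReal.ofReal (t ^ (-(k:ℝ)-1)) := by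
    intro t ht
    have ht : 0 < t := hr.trans ht
    rw [← ENNReal.ofReal_pow (by positivity)]
    congr 1
    rw [show (-(k:ℝ)-1) = -((k+1:ℕ):ℝ) by push_cast; ring, Real.rpow_neg ht.le, Real.rpow_natCast, inv_pow]
  rw [setLIntegral_congr_fun measurableSet_Ioi h1]
  rw [← ofReal_integral_eq_lintegral_ofReal]
  · rw [integral_Ioi_rpow_of_lt (by linarith) hr, ← ENNReal.ofReal_pow (by positivity)]
    refine ENNReal.ofReal_le_ofReal ?_
    rw [show (-(k:ℝ)-1+1) = -(k:ℝ) by ring, Real.rpow_neg hr.le, Real.rpow_natCast, neg_div_neg_eq, inv_pow]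
    exact div_le_self (by positivity) hk'
  · exact integrableOn_Ioi_rpow_of_lt (by linarith) hr
  · filter_upwards [self_mem_ae_restrict measurableSet_Ioi] with t ht
    have ht : 0 < t := hr.trans ht
    positivity

theorem Qset_meas {n : ℕ} {Ω : Set (Euc n)} {d : Euc n → ℝ} {c r : ℝ} (G : Geom n Ω d c r) :
    MeasurableSet (Qset n d) := by
  have hd : Continuous d := G.smooth.continuous
  exact (measurableSet_lt measurable_const measurable_fst).inter
    (measurableSet_lt measurable_fst (hd.measurable.comp measurable_snd))

theorem energy_le {n : ℕ} (hn : 1 ≤ n) {Ω : Set (Euc n)} {d : Euc n → ℝ} {c r : ℝ} (G : Geom n Ω d c r)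
    (hΩ : MeasurableSet Ω) {F : Type*} [NormedAddCommGroup F] [MeasurableSpace F] [BorelSpace F] [SecondCountableTopology F]
    {g : Euc n → F} (hg : Measurable g) :
    ∫⁻ z in Qset n d, Jn n g z ≤ Sen n Ω g := by
  set K : ℝ × Euc n → Euc n → ENNReal := fun z y =>
    Set.indicator {p : (ℝ × Euc n) × Euc n | p.1 ∈ Qset n d ∧ dist p.2 p.1.2 ≤ p.1.1}
      (fun p => ENNReal.ofReal p.1.1⁻¹ ^ (2*n+1) * ‖g p.2 - g p.1.2‖ₑ ^ (n+1)) (z, y) with hK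
  have hmeas : Measurable (Function.uncurry K) := by
    have h1 : Measurable (fun p : (ℝ × Euc n) × Euc n =>
        ENNReal.ofReal p.1.1⁻¹ ^ (2*n+1) * ‖g p.2 - g p.1.2‖ₑ ^ (n+1)) :=
      (((measurable_fst.comp measurable_fst).inv.ennreal_ofReal).pow_const _).mul
       ((((hg.comp measurable_snd).sub (hg.comp (measurable_snd.comp measurable_fst))).enorm).pow_const _)
    have h2 : MeasurableSet {p : (ℝ × Euc n) × Euc n | p.1 ∈ Qset n d ∧ dist p.2 p.1.2 ≤ p.1.1} :=
      ((Qset_meas G).preimage measurable_fst).inter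
        (measurableSet_le (f := fun p : (ℝ × Euc n) × Euc n => dist p.2 p.1.2) (g := fun p => p.1.1)
          (by fun_prop) (by fun_prop))
    exact h1.indicator h2
  have e1 : ∫⁻ z in Qset n d, Jn n g z = ∫⁻ z, ∫⁻ y, K z y := by
    rw [← lintegral_indicator (Qset_meas G)]
    refine lintegral_congr fun z => ?_
    by_cases hz : z ∈ Qset n d
    · rw [Set.indicator_of_mem hz, Jn, ← lintegral_indicator measurableSet_closedBall, ← lintegral_const_mul']
      · refine lintegral_congr fun y => ?_
        by_cases hy : dist y z.2 ≤ z.1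
        · simp [K, Set.indicator, hz, hy]
        · simp [K, Set.indicator, hz, hy]
      · exact ENNReal.pow_ne_top ENNReal.ofReal_ne_top
    · rw [Set.indicator_of_notMem hz]
      simp [K, Set.indicator, hz]
  have e2 : ∫⁻ z, ∫⁻ y, K z y = ∫⁻ x, ∫⁻ y, ∫⁻ t, K (t, x) y := by
    rw [Measure.volume_eq_prod, lintegral_prod_symm]
    · refine lintegral_congr fun x => ?_
      rw [lintegral_lintegral_swap]
      exact (hmeas.comp (f := fun p : ℝ × Euc n => ((p.1, x), p.2)) (by fun_prop)).aemeasurable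
    · exact hmeas.lintegral_prod_right'.aemeasurable
  rw [e1, e2, Sen, ← lintegral_indicator hΩ]
  refine lintegral_mono fun x => ?_
  by_cases hx : x ∈ Ω
  · rw [Set.indicator_of_mem hx, ← lintegral_indicator hΩ]
    refine lintegral_mono fun y => ?_
    by_cases hxy : y = x
    · subst hxy
      refine le_trans (le_of_eq ?_) zero_le
      simp [K, Set.indicator]
    by_cases hy : y ∈ Ω
    · rw [Set.indicator_of_mem hy]
      have hpos : 0 < dist y x := dist_pos.2 hxy
      have hle : ∀ t, K (t, x) y ≤ Set.indicator (Set.Ici (dist y x)) (fun t => ‖g x - g y‖ₑ ^ (n+1) * ENNReal.ofReal t⁻¹ ^ (2*n+1)) t := by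
        intro t
        by_cases ht : dist y x ≤ t
        · rw [Set.indicator_of_mem (by exact ht)]
          refine (Set.indicator_le_self _ _ _).trans (le_of_eq ?_)
          simp only
          rw [mul_comm, ← enorm_neg, neg_sub]
        · simp [K, Set.indicator, ht]
      refine (lintegral_mono hle).trans ?_
      rw [lintegral_indicator measurableSet_Ici, lintegral_const_mul']
      · rw [dist_comm x y]
        gcongr
        exact lint_pow hpos (by omega)
      · exact ENNReal.pow_ne_top enorm_ne_top
    · rw [Set.indicator_of_notMem hy]
      refine le_of_eq ?_
      rw [lintegral_eq_zero_iff' (by exact (hmeas.comp (f := fun t : ℝ => ((t, x), y)) (by fun_prop)).aemeasurable)]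
      refine Filter.Eventually.of_forall fun t => ?_
      refine Set.indicator_of_notMem ?_ _
      rintro ⟨h1, h2⟩
      exact hy (G.mem_of_dist hx (lt_of_le_of_lt h2 h1.2))
  · rw [Set.indicator_of_notMem hx]
    refine le_of_eq ?_
    have : ∀ t y, K (t, x) y = 0 := by
      intro t y
      refine Set.indicator_of_notMem ?_ _
      rintro ⟨h1, h2⟩
      exact hx ((G.mem x).2 (h1.1.trans h1.2))
    simp [this]

theorem ennreal_add_pow (a b : ENNReal) (m : ℕ) : (a + b) ^ m ≤ 2 ^ m * (a ^ m + b ^ m) := by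
  wlog h : a ≤ b generalizing a b
  · rw [add_comm a b, add_comm (a^m)]; exact this b a (le_of_not_ge h)
  calc (a + b) ^ m ≤ (2 * b) ^ m := by gcongr; rw [two_mul]; gcongr
    _ = 2 ^ m * b ^ m := mul_pow _ _ _
    _ ≤ _ := by gcongr; exact le_add_self

/-- cutoff -/
def phi {n : ℕ} (d : Euc n → ℝ) (z : ℝ × Euc n) : ℝ := Real.smoothTransition (z.1⁻¹ * d z.2 - 2)

/-- extension of the test function -/
def Psi (n : ℕ) (d : Euc n → ℝ) (ψ : Euc n → ℝ) (z : ℝ × Euc n) : ℝ := phi d z * moll n ψ z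

theorem phi_contDiffOn {n : ℕ} {d : Euc n → ℝ} (hd : ContDiff ℝ (⊤:ℕ∞) d) :
    ContDiffOn ℝ (⊤:ℕ∞) (phi d) (Set.Ioi 0 ×ˢ Set.univ) := by
  have h1 : ContDiffOn ℝ (⊤:ℕ∞) (fun z : ℝ × Euc n => z.1⁻¹ * d z.2 - 2) (Set.Ioi 0 ×ˢ Set.univ) := by
    refine ContDiffOn.sub (ContDiffOn.mul (ContDiffOn.inv contDiff_fst.contDiffOn ?_)
      (hd.comp contDiff_snd).contDiffOn) contDiffOn_const
    intro z hz; exact (show 0 < z.1 from hz.1).ne'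
  exact (Real.smoothTransition.contDiff (n := (⊤:ℕ∞))).comp_contDiffOn h1

theorem phi_zero {n : ℕ} {d : Euc n → ℝ} {z : ℝ × Euc n} (hz : 0 < z.1) (h : d z.2 ≤ 2 * z.1) :
    phi d z = 0 := by
  refine Real.smoothTransition.zero_of_nonpos ?_
  have : z.1⁻¹ * d z.2 ≤ z.1⁻¹ * (2 * z.1) := by gcongr
  have e : z.1⁻¹ * (2 * z.1) = 2 := by field_simp
  linarith

theorem phi_one {n : ℕ} {d : Euc n → ℝ} {z : ℝ × Euc n} (hz : 0 < z.1) (h : 3 * z.1 ≤ d z.2) :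
    phi d z = 1 := by
  refine Real.smoothTransition.one_of_one_le ?_
  have : z.1⁻¹ * (3 * z.1) ≤ z.1⁻¹ * d z.2 := by gcongr
  have e : z.1⁻¹ * (3 * z.1) = 3 := by field_simp
  linarith

theorem Psi_contDiffOn {n : ℕ} {d : Euc n → ℝ} (hd : ContDiff ℝ (⊤:ℕ∞) d) {ψ : Euc n → ℝ}
    (hψ : LocallyIntegrable ψ) : ContDiffOn ℝ (⊤:ℕ∞) (Psi n d ψ) (Set.Ioi 0 ×ˢ Set.univ) :=
  (phi_contDiffOn hd).mul (moll_contDiffOn hψ)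

theorem Psi_fderiv_zero {n : ℕ} {d : Euc n → ℝ} (hd : Continuous d) {ψ : Euc n → ℝ}
    {z : ℝ × Euc n} (hz : 0 < z.1) (h : d z.2 < 2 * z.1) : fderiv ℝ (Psi n d ψ) z = 0 := by
  have : Psi n d ψ =ᶠ[𝓝 z] fun _ => 0 := by
    have o1 : IsOpen {z : ℝ × Euc n | 0 < z.1 ∧ d z.2 < 2 * z.1} :=
      (isOpen_lt continuous_const continuous_fst).inter (isOpen_lt (f := fun z : ℝ × Euc n => d z.2) (g := fun z => 2 * z.1) (by fun_prop) (by fun_prop))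
    filter_upwards [o1.mem_nhds ⟨hz, h⟩] with w hw
    rw [Psi, phi_zero hw.1 hw.2.le, zero_mul]
  rw [this.fderiv_eq]; simp

theorem phi_fderiv_zero {n : ℕ} {d : Euc n → ℝ} (hd : Continuous d) 
    {z : ℝ × Euc n} (hz : 0 < z.1) (h : 3 * z.1 < d z.2) : fderiv ℝ (phi d) z = 0 := by
  have : phi d =ᶠ[𝓝 z] fun _ => 1 := by
    have o1 : IsOpen {z : ℝ × Euc n | 0 < z.1 ∧ 3 * z.1 < d z.2} :=
      (isOpen_lt continuous_const continuous_fst).inter (isOpen_lt (f := fun z : ℝ × Euc n => 3 * z.1) (g := fun z => d z.2) (by fun_prop) (by fun_prop))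
    filter_upwards [o1.mem_nhds ⟨hz, h⟩] with w hw
    exact phi_one hw.1 hw.2.le
  rw [this.fderiv_eq]; simp

theorem phi_fderiv_bound : ∃ K : ℝ, 0 < K ∧ ∀ {n : ℕ} {Ω : Set (Euc n)} {d : Euc n → ℝ} {c r : ℝ},
    Geom n Ω d c r → ∀ z : ℝ × Euc n, 0 < z.1 → 2 * z.1 ≤ d z.2 → d z.2 ≤ 3 * z.1 →
    ‖fderiv ℝ (phi d) z‖ ≤ K * z.1⁻¹ := by
  have hsm : ContDiff ℝ (⊤:ℕ∞) Real.smoothTransition := Real.smoothTransition.contDiff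
  have hc : Continuous (deriv Real.smoothTransition) := hsm.continuous_deriv (by simp)
  obtain ⟨K, hK⟩ := (isCompact_Icc (a := (0:ℝ)) (b := 1)).exists_bound_of_continuousOn hc.continuousOn
  have hK0 : 0 ≤ K := (norm_nonneg _).trans (hK 0 (by simp))
  refine ⟨(K+1) * 4, by positivity, ?_⟩
  intro n Ω d c r G z hz h2 h3
  have hxΩ : z.2 ∈ Ω := (G.mem _).2 (by linarith)
  have hdd : HasFDerivAt d (fderiv ℝ d z.2) z.2 := (G.smooth.differentiable (by simp) _).hasFDerivAt
  have hdd2 := hdd.comp z (hasFDerivAt_snd (𝕜 := ℝ) (E := ℝ) (F := Euc n))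
  have hinv := (hasDerivAt_inv hz.ne').hasFDerivAt.comp z (hasFDerivAt_fst (𝕜 := ℝ) (E := ℝ) (F := Euc n))
  have hm := (hinv.mul hdd2).sub_const 2
  have hs : HasFDerivAt Real.smoothTransition (ContinuousLinearMap.toSpanSingleton ℝ (deriv Real.smoothTransition (z.1⁻¹ * d z.2 - 2)))
      (z.1⁻¹ * d z.2 - 2) :=
    (hsm.differentiable (by simp) _).hasDerivAt.hasFDerivAt
  have hph : HasFDerivAt (phi d) _ z := HasFDerivAt.comp z (g := Real.smoothTransition) hs hm
  rw [hph.fderiv]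
  refine (ContinuousLinearMap.opNorm_comp_le _ _).trans ?_
  rw [ContinuousLinearMap.norm_toSpanSingleton]
  have hz1 : z.1⁻¹ * d z.2 - 2 ∈ Set.Icc (0:ℝ) 1 := by
    have e : z.1⁻¹ * (2 * z.1) = 2 := by field_simp
    have e' : z.1⁻¹ * (3 * z.1) = 3 := by field_simp
    have : z.1⁻¹ * (2 * z.1) ≤ z.1⁻¹ * d z.2 := by gcongr
    have : z.1⁻¹ * d z.2 ≤ z.1⁻¹ * (3 * z.1) := by gcongr
    constructor <;> linarith
  have b1 := hK _ hz1
  rw [mul_assoc]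
  refine mul_le_mul (b1.trans (by linarith)) ?_ (norm_nonneg _) (by positivity)
  refine (norm_add_le _ _).trans ?_
  rw [norm_smul, norm_smul]
  simp only [Function.comp_apply]
  have n1 : ‖(fderiv ℝ d z.2).comp (ContinuousLinearMap.snd ℝ ℝ (Euc n))‖ ≤ 1 * 1 :=
    (ContinuousLinearMap.opNorm_comp_le _ _).trans (mul_le_mul (G.grad _ hxΩ)
      (ContinuousLinearMap.norm_snd_le ..) (norm_nonneg _) zero_le_one)
  have n2 : ‖(ContinuousLinearMap.toSpanSingleton ℝ (-(z.1 ^ 2)⁻¹)).comp (ContinuousLinearMap.fst ℝ ℝ (Euc n))‖ ≤ (z.1^2)⁻¹ * 1 := by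
    refine (ContinuousLinearMap.opNorm_comp_le _ _).trans (mul_le_mul ?_
      (ContinuousLinearMap.norm_fst_le ..) (norm_nonneg _) (by positivity))
    rw [ContinuousLinearMap.norm_toSpanSingleton, norm_neg, Real.norm_of_nonneg (by positivity)]
  have n3 : ‖d z.2‖ ≤ 3 * z.1 := by rw [Real.norm_of_nonneg (by linarith)]; exact h3
  have n4 : ‖z.1⁻¹‖ = z.1⁻¹ := Real.norm_of_nonneg (by positivity)
  calc _ ≤ z.1⁻¹ * (1 * 1) + (3 * z.1) * ((z.1^2)⁻¹ * 1) := by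
        rw [n4]
        exact add_le_add (by gcongr) (mul_le_mul n3 n2 (norm_nonneg _) (by positivity))
    _ = 4 * z.1⁻¹ := by field_simp; norm_num

/-- The Hardy energy -/
def Hen (n : ℕ) (Ω : Set (Euc n)) (d : Euc n → ℝ) (ψ : Euc n → ℝ) : ENNReal :=
  ∫⁻ x in Ω, ‖ψ x‖ₑ ^ (n+1) * ENNReal.ofReal (d x)⁻¹ ^ n

/-- The layer region -/
def Tset (n : ℕ) (d : Euc n → ℝ) : Set (ℝ × Euc n) := {z | 0 < z.1 ∧ 2 * z.1 ≤ d z.2 ∧ d z.2 ≤ 3 * z.1}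

theorem Tset_meas {n : ℕ} {d : Euc n → ℝ} (hd : Continuous d) : MeasurableSet (Tset n d) :=
  (measurableSet_lt measurable_const measurable_fst).inter
    ((measurableSet_le (f := fun z : ℝ × Euc n => 2 * z.1) (g := fun z => d z.2) (by fun_prop) (by fun_prop)).inter
     (measurableSet_le (f := fun z : ℝ × Euc n => d z.2) (g := fun z => 3 * z.1) (by fun_prop) (by fun_prop)))

theorem grad_Psi {n : ℕ} (hn : 1 ≤ n) : ∃ C : ENNReal, C ≠ ⊤ ∧ ∀ {Ω : Set (Euc n)} {d : Euc n → ℝ} {c r : ℝ},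
    Geom n Ω d c r → ∀ ψ : Euc n → ℝ, LocallyIntegrable ψ → ∀ z : ℝ × Euc n, 0 < z.1 →
    ‖fderiv ℝ (Psi n d ψ) z‖ₑ ^ (n+1) ≤ C * ((Qset n d).indicator (Jn n ψ) z +
      (Tset n d).indicator (fun z => ENNReal.ofReal z.1⁻¹ ^ (n+1) * ‖ψ z.2‖ₑ ^ (n+1)) z) := by
  obtain ⟨C, hC, hE⟩ := moll_energy hn
  obtain ⟨K, hK, hphi⟩ := phi_fderiv_bound
  set k := ENNReal.ofReal K
  have hk : k ≠ ⊤ := ENNReal.ofReal_ne_top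
  refine ⟨2^(n+1) * (2^(n+1) * (C + k^(n+1) * C) + k^(n+1)), ?_, ?_⟩
  · finiteness
  intro Ω d c r G ψ hψ z hz
  have hdc : Continuous d := G.smooth.continuous
  have hz0 : ‖(0 : ℝ × Euc n →L[ℝ] ℝ)‖ₑ = 0 := by rw [← ofReal_norm, norm_zero, ENNReal.ofReal_zero]
  rcases lt_or_ge (d z.2) (2 * z.1) with h | h
  · rw [Psi_fderiv_zero hdc hz h, hz0, zero_pow (by omega)]; exact zero_le
  have hzQ : z ∈ Qset n d := ⟨hz, by linarith⟩
  rw [Set.indicator_of_mem hzQ]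
  have hzh : z ∈ Set.Ioi (0:ℝ) ×ˢ (Set.univ : Set (Euc n)) := ⟨hz, trivial⟩
  have d1 : DifferentiableAt ℝ (phi d) z :=
    ((phi_contDiffOn G.smooth).contDiffAt ((isOpen_half n).mem_nhds hzh)).differentiableAt (by simp)
  have d2 : DifferentiableAt ℝ (moll n ψ) z := moll_differentiableAt hψ hz
  have e0 : fderiv ℝ (Psi n d ψ) z = phi d z • fderiv ℝ (moll n ψ) z + moll n ψ z • fderiv ℝ (phi d) z :=
    fderiv_mul d1 d2
  have en := enorm_add_le (phi d z • fderiv ℝ (moll n ψ) z) (moll n ψ z • fderiv ℝ (phi d) z)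
  rw [← e0, enorm_smul, enorm_smul] at en
  have p1 : ‖phi d z‖ₑ ≤ 1 := by
    rw [← ofReal_norm, ← ENNReal.ofReal_one]
    refine ENNReal.ofReal_le_ofReal ?_
    rw [phi, Real.norm_of_nonneg (Real.smoothTransition.nonneg _)]
    exact Real.smoothTransition.le_one _
  obtain ⟨E1, E2⟩ := hE ψ hψ z.1 hz z.2
  have hz2 : (z.1, z.2) = z := rfl
  rw [hz2] at E1 E2
  set A := ‖fderiv ℝ (moll n ψ) z‖ₑ
  have en2 : ‖fderiv ℝ (Psi n d ψ) z‖ₑ ≤ A + ‖moll n ψ z‖ₑ * ‖fderiv ℝ (phi d) z‖ₑ :=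
    en.trans (by gcongr; exact mul_le_of_le_one_left' p1)
  rcases lt_or_ge (3 * z.1) (d z.2) with h3 | h3
  · rw [phi_fderiv_zero hdc hz h3, hz0, mul_zero, add_zero] at en2
    calc _ ≤ A ^ (n+1) := pow_le_pow_left' en2 _
      _ ≤ C * Jn n ψ z := E1
      _ ≤ (2^(n+1) * (2^(n+1) * (C + k^(n+1) * C) + k^(n+1))) * Jn n ψ z := by
        gcongr
        have h2 : (1:ENNReal) ≤ 2^(n+1) := one_le_pow_of_one_le' (by norm_num) _
        calc C ≤ C + k^(n+1) * C := le_self_add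
          _ ≤ 2^(n+1) * (C + k^(n+1) * C) := le_mul_of_one_le_left' h2
          _ ≤ 2^(n+1) * (C + k^(n+1) * C) + k^(n+1) := le_self_add
          _ ≤ _ := le_mul_of_one_le_left' h2
      _ ≤ _ := by gcongr; exact le_self_add
  · have hT : z ∈ Tset n d := ⟨hz, h, h3⟩
    rw [Set.indicator_of_mem hT]
    have b := hphi G z hz h h3
    have b' : ‖fderiv ℝ (phi d) z‖ₑ ≤ k * ENNReal.ofReal z.1⁻¹ := by
      rw [← ofReal_norm, ← ENNReal.ofReal_mul hK.le]; exact ENNReal.ofReal_le_ofReal b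
    have m1 : ‖moll n ψ z‖ₑ ≤ ‖moll n ψ z - ψ z.2‖ₑ + ‖ψ z.2‖ₑ := by
      calc ‖moll n ψ z‖ₑ = ‖(moll n ψ z - ψ z.2) + ψ z.2‖ₑ := by rw [sub_add_cancel]
        _ ≤ _ := enorm_add_le _ _
    set a := ENNReal.ofReal z.1⁻¹
    set M := ‖moll n ψ z - ψ z.2‖ₑ
    set P := ‖ψ z.2‖ₑ
    have en3 : ‖fderiv ℝ (Psi n d ψ) z‖ₑ ≤ (A + k * (a * M)) + k * (a * P) := by
      refine en2.trans ?_
      calc A + ‖moll n ψ z‖ₑ * ‖fderiv ℝ (phi d) z‖ₑ ≤ A + (M + P) * (k * a) := by gcongr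
        _ = _ := by ring
    calc _ ≤ ((A + k * (a * M)) + k * (a * P)) ^ (n+1) := pow_le_pow_left' en3 _
      _ ≤ 2^(n+1) * ((A + k * (a * M))^(n+1) + (k * (a * P))^(n+1)) := ennreal_add_pow _ _ _
      _ ≤ 2^(n+1) * (2^(n+1) * (A^(n+1) + (k * (a * M))^(n+1)) + (k * (a * P))^(n+1)) := by
        gcongr; exact ennreal_add_pow _ _ _
      _ = 2^(n+1) * (2^(n+1) * (A^(n+1) + k^(n+1) * (a * M)^(n+1)) + k^(n+1) * (a^(n+1) * P^(n+1))) := by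
        rw [mul_pow k, mul_pow k, mul_pow a P]
      _ ≤ 2^(n+1) * (2^(n+1) * (C * Jn n ψ z + k^(n+1) * (C * Jn n ψ z)) + k^(n+1) * (a^(n+1) * P^(n+1))) := by
        gcongr
      _ = 2^(n+1) * (2^(n+1) * (C + k^(n+1) * C) * Jn n ψ z + k^(n+1) * (a^(n+1) * P^(n+1))) := by ring
      _ ≤ 2^(n+1) * ((2^(n+1) * (C + k^(n+1) * C) + k^(n+1)) * Jn n ψ z +
            (2^(n+1) * (C + k^(n+1) * C) + k^(n+1)) * (a^(n+1) * P^(n+1))) := by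
        gcongr
        · exact le_self_add
        · exact le_add_self
      _ = _ := by ring

theorem layer_int {n : ℕ} {Ω : Set (Euc n)} {d : Euc n → ℝ} {c r : ℝ} (G : Geom n Ω d c r)
    (hΩ : MeasurableSet Ω) {ψ : Euc n → ℝ} (hψ : Measurable ψ) :
    ∫⁻ z, (Tset n d).indicator (fun z => ENNReal.ofReal z.1⁻¹ ^ (n+1) * ‖ψ z.2‖ₑ ^ (n+1)) z ≤
      3 ^ (n+1) * Hen n Ω d ψ := by
  have hdc : Continuous d := G.smooth.continuous
  have hm : Measurable ((Tset n d).indicator (fun z : ℝ × Euc n => ENNReal.ofReal z.1⁻¹ ^ (n+1) * ‖ψ z.2‖ₑ ^ (n+1))) := by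
    refine Measurable.indicator ?_ (Tset_meas hdc)
    exact ((measurable_fst.inv.ennreal_ofReal).pow_const _).mul (((hψ.comp measurable_snd).enorm).pow_const _)
  rw [Measure.volume_eq_prod, lintegral_prod_symm _ hm.aemeasurable, Hen, ← lintegral_const_mul', ← lintegral_indicator hΩ]
  · refine lintegral_mono fun x => ?_
    by_cases hx : x ∈ Ω
    · rw [Set.indicator_of_mem hx]
      have hd : 0 < d x := (G.mem x).1 hx
      have hle : ∀ t, (Tset n d).indicator (fun z : ℝ × Euc n => ENNReal.ofReal z.1⁻¹ ^ (n+1) * ‖ψ z.2‖ₑ ^ (n+1)) (t, x) ≤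
          (Set.Icc 0 (d x)).indicator (fun t => 3 ^ (n+1) * (ENNReal.ofReal (d x)⁻¹ ^ (n+1) * ‖ψ x‖ₑ ^ (n+1))) t := by
        intro t
        by_cases ht : (t, x) ∈ Tset n d
        · rw [Set.indicator_of_mem ht]
          obtain ⟨h1, h2, h3⟩ := ht
          simp only at h1 h2 h3
          rw [Set.indicator_of_mem (show t ∈ Set.Icc 0 (d x) from ⟨h1.le, by linarith⟩)]
          show ENNReal.ofReal t⁻¹ ^ (n+1) * ‖ψ x‖ₑ ^ (n+1) ≤ 3 ^ (n+1) * (ENNReal.ofReal (d x)⁻¹ ^ (n+1) * ‖ψ x‖ₑ ^ (n+1))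
          rw [← mul_assoc, ← mul_pow 3]
          refine mul_le_mul' (pow_le_pow_left' ?_ _) (le_refl (‖ψ x‖ₑ ^ (n+1)))
          rw [show (3:ENNReal) = ENNReal.ofReal 3 by simp, ← ENNReal.ofReal_mul (by norm_num)]
          refine ENNReal.ofReal_le_ofReal ?_
          rw [← div_eq_mul_inv, inv_eq_one_div, div_le_div_iff₀ h1 hd]; linarith
        · rw [Set.indicator_of_notMem ht]; exact zero_le
      refine (lintegral_mono hle).trans ?_
      rw [lintegral_indicator measurableSet_Icc, setLIntegral_const, Real.volume_Icc, sub_zero]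
      have hab : ENNReal.ofReal (d x)⁻¹ * ENNReal.ofReal (d x) = 1 := by
        rw [← ENNReal.ofReal_mul (by positivity), inv_mul_cancel₀ hd.ne', ENNReal.ofReal_one]
      refine le_of_eq ?_
      calc _ = 3 ^ (n+1) * (‖ψ x‖ₑ ^ (n+1) * ENNReal.ofReal (d x)⁻¹ ^ n) * (ENNReal.ofReal (d x)⁻¹ * ENNReal.ofReal (d x)) := by ring
        _ = _ := by rw [hab, mul_one]
    · rw [Set.indicator_of_notMem hx]
      refine le_of_eq ?_
      have : ∀ t : ℝ, (Tset n d).indicator (fun z : ℝ × Euc n => ENNReal.ofReal z.1⁻¹ ^ (n+1) * ‖ψ z.2‖ₑ ^ (n+1)) (t, x) = 0 := by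
        intro t
        refine Set.indicator_of_notMem ?_ _
        rintro ⟨h1, h2, h3⟩
        simp only at h1 h2 h3
        exact hx ((G.mem x).2 (by linarith))
      simp [this]
  · finiteness

theorem grad_Psi_int {n : ℕ} (hn : 1 ≤ n) : ∃ C : ENNReal, C ≠ ⊤ ∧ ∀ {Ω : Set (Euc n)} {d : Euc n → ℝ} {c r : ℝ},
    Geom n Ω d c r → MeasurableSet Ω → ∀ ψ : Euc n → ℝ, LocallyIntegrable ψ → Measurable ψ →
    ∫⁻ z in Set.Ioi 0 ×ˢ Set.univ, ‖fderiv ℝ (Psi n d ψ) z‖ₑ ^ (n+1) ≤ C * (Sen n Ω ψ + Hen n Ω d ψ) := by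
  obtain ⟨C, hC, h⟩ := grad_Psi hn
  refine ⟨C * 3 ^ (n+1), by finiteness, fun {Ω d c r} G hΩ ψ hψ hψm => ?_⟩
  refine (setLIntegral_mono' (isOpen_half n).measurableSet (fun z hz => h G ψ hψ z hz.1)).trans ?_
  rw [lintegral_const_mul' _ _ hC, mul_assoc]
  gcongr
  have hdc : Continuous d := G.smooth.continuous
  have hm : Measurable ((Tset n d).indicator (fun z : ℝ × Euc n => ENNReal.ofReal z.1⁻¹ ^ (n+1) * ‖ψ z.2‖ₑ ^ (n+1))) := by
    refine Measurable.indicator ?_ (Tset_meas hdc)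
    exact ((measurable_fst.inv.ennreal_ofReal).pow_const _).mul (((hψm.comp measurable_snd).enorm).pow_const _)
  rw [lintegral_add_right _ hm]
  have h3 : (1:ENNReal) ≤ 3^(n+1) := one_le_pow_of_one_le' (by norm_num) _
  calc _ ≤ (∫⁻ z, (Qset n d).indicator (Jn n ψ) z) + ∫⁻ z, (Tset n d).indicator (fun z => ENNReal.ofReal z.1⁻¹ ^ (n+1) * ‖ψ z.2‖ₑ ^ (n+1)) z :=
        add_le_add (setLIntegral_le_lintegral _ _) (setLIntegral_le_lintegral _ _)
    _ ≤ Sen n Ω ψ + 3^(n+1) * Hen n Ω d ψ := by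
        refine add_le_add ?_ (layer_int G hΩ hψm)
        rw [lintegral_indicator (Qset_meas G)]
        exact energy_le hn G hΩ hψm
    _ ≤ _ := by
        rw [mul_add]; gcongr; exact le_mul_of_one_le_left' h3

theorem lint_scale {n : ℕ} (f : Euc n → ENNReal) {r : ℝ} (hr : 0 < r) :
    ∫⁻ x, f (r⁻¹ • x) = ENNReal.ofReal (r ^ n) * ∫⁻ x, f x := by
  have h := Measure.map_addHaar_smul (volume : Measure (Euc n)) (inv_ne_zero hr.ne')
  have e : ∫⁻ x, f (r⁻¹ • x) = ∫⁻ x, f x ∂(Measure.map (fun x : Euc n => r⁻¹ • x) volume) := by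
    exact (lintegral_map_equiv f (Homeomorph.smulOfNeZero r⁻¹ (inv_ne_zero hr.ne')).toMeasurableEquiv).symm
  rw [e]
  have h2 : Measure.map (fun x : Euc n => r⁻¹ • x) volume = ENNReal.ofReal |(r⁻¹ ^ Module.finrank ℝ (Euc n))⁻¹| • volume := h
  rw [h2, lintegral_smul_measure, finrank_euclideanSpace_fin, inv_pow, inv_inv, abs_of_pos (by positivity), smul_eq_mul]

/-- the scale invariant integral -/
def Icon (n : ℕ) : ENNReal := ∫⁻ x : Euc n, ENNReal.ofReal ((1 + ‖x‖)⁻¹) ^ (2*n)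

theorem Icon_lt {n : ℕ} (hn : 1 ≤ n) : Icon n ≠ ⊤ := by
  have := finite_integral_one_add_norm (μ := (volume : Measure (Euc n))) (r := ((2*n : ℕ):ℝ)) (by
    rw [finrank_euclideanSpace_fin]; exact_mod_cast (by omega))
  refine ne_of_lt (lt_of_le_of_lt (le_of_eq ?_) this)
  refine lintegral_congr fun x => ?_
  rw [← ENNReal.ofReal_pow (by positivity), Real.rpow_neg (by positivity), Real.rpow_natCast, inv_pow]

theorem kernel_int {n : ℕ} {K s : ℝ} (hK : 0 < K) (hs : 0 < s) (y : Euc n) :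
    ∫⁻ x, ENNReal.ofReal (2 / s * (1 + dist x y / (K * s))⁻¹) ^ (2*n) =
      ENNReal.ofReal (4 ^ n * K ^ n * s⁻¹ ^ n) * Icon n := by
  have e : ∀ x, ENNReal.ofReal (2 / s * (1 + dist x y / (K * s))⁻¹) ^ (2*n) =
      (fun z : Euc n => ENNReal.ofReal ((2/s)^(2*n)) * (fun w : Euc n => ENNReal.ofReal ((1 + ‖w‖)⁻¹) ^ (2*n)) ((K*s)⁻¹ • z)) (x - y) := by
    intro x
    simp only
    rw [norm_smul, ENNReal.ofReal_mul (by positivity), mul_pow, ENNReal.ofReal_pow (by positivity), dist_eq_norm,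
      Real.norm_of_nonneg (by positivity : 0 ≤ (K*s)⁻¹), div_eq_inv_mul ‖x - y‖]
  rw [lintegral_congr e, lintegral_sub_right_eq_self (μ := (volume : Measure (Euc n))) (fun z : Euc n => ENNReal.ofReal ((2/s)^(2*n)) * (fun w : Euc n => ENNReal.ofReal ((1 + ‖w‖)⁻¹) ^ (2*n)) ((K*s)⁻¹ • z)) y, lintegral_const_mul' _ _ ENNReal.ofReal_ne_top,
    lint_scale (fun w : Euc n => ENNReal.ofReal ((1 + ‖w‖)⁻¹) ^ (2*n)) (by positivity : 0 < K * s), ← mul_assoc, ← ENNReal.ofReal_mul (by positivity)]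
  rw [Icon]
  congr 2
  rw [mul_pow, div_pow, pow_mul 2, inv_pow, pow_mul' s]; norm_num
  field_simp

theorem hardy_point {n : ℕ} {Ω : Set (Euc n)} {d : Euc n → ℝ} 
    {K m l : ℝ} (hK : 0 < K) (hm : 0 < m) (hl : 0 < l)  {ψ : Euc n → ℝ} {x : Euc n} (hd : 0 < d x)
    (hpos : ∀ y ∈ Ω, 0 < d y)
    (hΩ : MeasurableSet Ω) (hdc : Continuous d)
    (h : ENNReal.ofReal (m*l*d x^n) ≤ volume {y | y ∈ Ω ∧ dist x y ≤ K*d x ∧ d y ≤ l*d x}) (hψ : Measurable ψ) :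
    ‖ψ x‖ₑ ^ (n+1) * ENNReal.ofReal (d x)⁻¹ ^ n ≤ ENNReal.ofReal (m*l)⁻¹ * 2 ^ (n+1) *
      (ENNReal.ofReal K ^ (2*n) * (∫⁻ y in Ω, ‖ψ x - ψ y‖ₑ ^ (n+1) * ENNReal.ofReal (dist x y)⁻¹ ^ (2*n)) +
       ∫⁻ y in Ω, ‖ψ y‖ₑ ^ (n+1) * ENNReal.ofReal (2 / (d y / l) * (1 + dist x y / (K * (d y / l)))⁻¹) ^ (2*n)) := by
  set A := {y | y ∈ Ω ∧ dist x y ≤ K*d x ∧ d y ≤ l*d x} with hA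
  have hAm : MeasurableSet A := hΩ.inter
    ((measurableSet_le (f := fun y => dist x y) (g := fun _ => K * d x) (by fun_prop) (by fun_prop)).inter
     (measurableSet_le (f := fun y => d y) (g := fun _ => l * d x) (by fun_prop) (by fun_prop)))
  set D := ENNReal.ofReal (d x)⁻¹ with hD
  have e1 : ‖ψ x‖ₑ ^ (n+1) * D ^ n = ENNReal.ofReal (m*l)⁻¹ * (D ^ (2*n) * (ENNReal.ofReal (m*l*d x^n) * ‖ψ x‖ₑ ^ (n+1))) := by
    have : ENNReal.ofReal (m*l)⁻¹ * (D ^ (2*n) * ENNReal.ofReal (m*l*d x^n)) = D ^ n := by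
      rw [hD, ← ENNReal.ofReal_pow (by positivity), ← ENNReal.ofReal_pow (by positivity), ← ENNReal.ofReal_mul (by positivity), ← ENNReal.ofReal_mul (by positivity)]
      congr 1
      rw [inv_pow, inv_pow, pow_mul']
      field_simp
    rw [← this]; ring
  have e2 : ENNReal.ofReal (m*l*d x^n) * ‖ψ x‖ₑ ^ (n+1) ≤ ∫⁻ y in A, 2^(n+1) * (‖ψ x - ψ y‖ₑ ^ (n+1) + ‖ψ y‖ₑ ^ (n+1)) := by
    calc _ ≤ volume A * ‖ψ x‖ₑ ^ (n+1) := by gcongr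
      _ = ∫⁻ y in A, ‖ψ x‖ₑ ^ (n+1) := by rw [setLIntegral_const, mul_comm]
      _ ≤ _ := by
        refine lintegral_mono fun y => ?_
        refine le_trans (pow_le_pow_left' ?_ _) (ennreal_add_pow _ _ _)
        calc ‖ψ x‖ₑ = ‖(ψ x - ψ y) + ψ y‖ₑ := by rw [sub_add_cancel]
          _ ≤ _ := enorm_add_le _ _
  rw [e1]
  have e3 : D ^ (2*n) * ∫⁻ y in A, 2^(n+1) * (‖ψ x - ψ y‖ₑ ^ (n+1) + ‖ψ y‖ₑ ^ (n+1)) ≤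
      ∫⁻ y in A, 2^(n+1) * ((ENNReal.ofReal K ^ (2*n) * (‖ψ x - ψ y‖ₑ ^ (n+1) * ENNReal.ofReal (dist x y)⁻¹ ^ (2*n))) + 
        ‖ψ y‖ₑ ^ (n+1) * ENNReal.ofReal (2 / (d y / l) * (1 + dist x y / (K * (d y / l)))⁻¹) ^ (2*n)) := by
    rw [← lintegral_const_mul' _ _ (by finiteness)]
    refine setLIntegral_mono' hAm fun y hy => ?_
    obtain ⟨hyΩ, h1, h2⟩ := hy
    have hdy := hpos y hyΩ
    rw [mul_left_comm, mul_add]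
    gcongr 2^(n+1) * (?_ + ?_)
    · rcases eq_or_lt_of_le (dist_nonneg (x := x) (y := y)) with h0 | h0
      · rw [dist_eq_zero.1 h0.symm]; simp
      · rw [mul_left_comm, mul_comm, ← mul_pow (ENNReal.ofReal K)]
        gcongr
        rw [← ENNReal.ofReal_mul hK.le]
        refine ENNReal.ofReal_le_ofReal ?_
        rw [← div_eq_mul_inv, inv_eq_one_div, div_le_div_iff₀ hd h0]; linarith
    · rw [mul_comm]
      gcongr
      refine ENNReal.ofReal_le_ofReal ?_
      have hq : 2 / (d y / l) * (1 + dist x y / (K * (d y / l)))⁻¹ = (((d y / l) + dist x y / K) / 2)⁻¹ := by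
        field_simp
      rw [hq]
      refine inv_anti₀ (by positivity) ?_
      have a1 : d y / l ≤ d x := by rw [div_le_iff₀ hl]; linarith
      have a2 : dist x y / K ≤ d x := by rw [div_le_iff₀ hK]; linarith
      linarith
  calc _ ≤ ENNReal.ofReal (m*l)⁻¹ * (D ^ (2*n) * ∫⁻ y in A, 2^(n+1) * (‖ψ x - ψ y‖ₑ ^ (n+1) + ‖ψ y‖ₑ ^ (n+1))) := by gcongr
    _ ≤ ENNReal.ofReal (m*l)⁻¹ * ∫⁻ y in Ω, 2^(n+1) * ((ENNReal.ofReal K ^ (2*n) * (‖ψ x - ψ y‖ₑ ^ (n+1) * ENNReal.ofReal (dist x y)⁻¹ ^ (2*n))) + 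
        ‖ψ y‖ₑ ^ (n+1) * ENNReal.ofReal (2 / (d y / l) * (1 + dist x y / (K * (d y / l)))⁻¹) ^ (2*n)) := by
      gcongr
      exact e3.trans (lintegral_mono_set fun y hy => hy.1)
    _ = _ := by
      have mm : Measurable fun y => ‖ψ x - ψ y‖ₑ ^ (n+1) * ENNReal.ofReal (dist x y)⁻¹ ^ (2*n) := by fun_prop
      rw [lintegral_const_mul' _ _ (by finiteness), lintegral_add_left (mm.const_mul _), lintegral_const_mul' _ _ (by finiteness), mul_assoc]

theorem hardy {n : ℕ} (hn : 2 ≤ n) {Ω : Set (Euc n)} {d : Euc n → ℝ} {c r : ℝ} (G : Geom n Ω d c r)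
    (hΩ : MeasurableSet Ω) : ∃ C : ENNReal, C ≠ ⊤ ∧ ∀ ψ : Euc n → ℝ, Measurable ψ → Hen n Ω d ψ ≠ ⊤ →
    Hen n Ω d ψ ≤ C * (Sen n Ω ψ + ∫⁻ x in Ω, ‖ψ x‖ₑ ^ (n+1)) := by
  obtain ⟨K, m, r1, hK, hm, hr1, hlay⟩ := G.layer
  have hdc : Continuous d := G.smooth.continuous
  have hI := Icon_lt (n := n) (by omega)
  -- choice of `l`
  set B : ℝ := m⁻¹ * 2^(n+1) * (4^n * K^n) * ((Icon n).toReal + 1) with hB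
  have hBpos : 0 < B := by positivity
  set l : ℝ := min 1 (2 * B)⁻¹ with hl
  have hl0 : 0 < l := lt_min one_pos (by positivity)
  have hl1 : l ≤ 1 := min_le_left _ _
  have hl2 : l ≤ (2*B)⁻¹ := min_le_right _ _
  set a : ENNReal := ENNReal.ofReal (m*l)⁻¹ * 2^(n+1) with ha
  have hatop : a ≠ ⊤ := by finiteness
  have hsmall : a * (ENNReal.ofReal (4^n * K^n * l^n) * Icon n) ≤ 2⁻¹ := by
    rw [ha, ← ENNReal.ofReal_toReal hI, show (2:ENNReal)^(n+1) = ENNReal.ofReal (2^(n+1)) by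
      rw [ENNReal.ofReal_pow (by norm_num)]; simp, ← ENNReal.ofReal_mul (by positivity), ← ENNReal.ofReal_mul (by positivity), ← ENNReal.ofReal_mul (by positivity),
      show (2:ENNReal)⁻¹ = ENNReal.ofReal 2⁻¹ by rw [ENNReal.ofReal_inv_of_pos (by norm_num)]; simp]
    refine ENNReal.ofReal_le_ofReal ?_
    obtain ⟨k, rfl⟩ : ∃ k, n = k + 2 := ⟨n - 2, by omega⟩
    have q1 : l ^ (k+2) ≤ l * l := by
      calc l^(k+2) = l^k * (l * l) := by ring
        _ ≤ 1 * (l*l) := by gcongr; exact pow_le_one₀ hl0.le hl1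
        _ = _ := one_mul _
    calc _ ≤ (m*l)⁻¹ * 2^(k+2+1) * (4^(k+2) * K^(k+2) * (l*l) * ((Icon (k+2)).toReal + 1)) := by
          gcongr; linarith
      _ = B * l := by rw [hB, mul_inv]; field_simp
      _ ≤ B * (2*B)⁻¹ := by gcongr
      _ = 2⁻¹ := by field_simp
  set S1 := a * ENNReal.ofReal K ^ (2*n) with hS1
  set S2 := ENNReal.ofReal r1⁻¹ ^ n with hS2
  refine ⟨2 * (S1 + S2), by finiteness, fun ψ hψ hfin => ?_⟩
  have km : Measurable (fun q : Euc n × Euc n => ‖ψ q.2‖ₑ ^ (n+1) * ENNReal.ofReal (2 / (d q.2 / l) * (1 + dist q.1 q.2 / (K * (d q.2 / l)))⁻¹) ^ (2*n)) := by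
    have : Measurable d := hdc.measurable
    fun_prop
  have main : Hen n Ω d ψ ≤ S2 * (∫⁻ x in Ω, ‖ψ x‖ₑ ^ (n+1)) + (S1 * Sen n Ω ψ + 2⁻¹ * Hen n Ω d ψ) := by
    have step : Hen n Ω d ψ ≤ ∫⁻ x in Ω, (S2 * ‖ψ x‖ₑ ^ (n+1) + (S1 * (∫⁻ y in Ω, ‖ψ x - ψ y‖ₑ ^ (n+1) * ENNReal.ofReal (dist x y)⁻¹ ^ (2*n)) +
       a * ∫⁻ y in Ω, ‖ψ y‖ₑ ^ (n+1) * ENNReal.ofReal (2 / (d y / l) * (1 + dist x y / (K * (d y / l)))⁻¹) ^ (2*n))) := by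
      refine setLIntegral_mono' hΩ fun x hx => ?_
      have hdx := (G.mem x).1 hx
      rcases lt_or_ge (d x) r1 with h | h
      · refine le_trans ?_ le_add_self
        refine (hardy_point hK hm hl0 hdx (fun y hy => (G.mem y).1 hy) hΩ hdc (hlay x hx h l hl0 hl1) hψ).trans (le_of_eq ?_)
        rw [mul_add, hS1, mul_assoc a]
      · refine le_trans ?_ le_self_add
        rw [mul_comm, hS2]
        gcongr
    refine step.trans ?_
    have sm : Measurable fun x => ∫⁻ y in Ω, ‖ψ x - ψ y‖ₑ ^ (n+1) * ENNReal.ofReal (dist x y)⁻¹ ^ (2*n) := by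
      refine Measurable.lintegral_prod_right' (f := fun q : Euc n × Euc n => ‖ψ q.1 - ψ q.2‖ₑ ^ (n+1) * ENNReal.ofReal (dist q.1 q.2)⁻¹ ^ (2*n)) ?_
      fun_prop
    rw [lintegral_add_left ((hψ.enorm.pow_const _).const_mul _), lintegral_add_left (sm.const_mul _),
      lintegral_const_mul' _ _ (by finiteness), lintegral_const_mul' _ _ (by finiteness), lintegral_const_mul' _ _ hatop]
    gcongr _ + (?_ + ?_)
    · exact le_rfl
    · calc _ ≤ a * ∫⁻ x, ∫⁻ y in Ω, ‖ψ y‖ₑ ^ (n+1) * ENNReal.ofReal (2 / (d y / l) * (1 + dist x y / (K * (d y / l)))⁻¹) ^ (2*n) := by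
            gcongr; exact Measure.restrict_le_self
        _ = a * ∫⁻ y in Ω, ∫⁻ x, ‖ψ y‖ₑ ^ (n+1) * ENNReal.ofReal (2 / (d y / l) * (1 + dist x y / (K * (d y / l)))⁻¹) ^ (2*n) := by
            rw [lintegral_lintegral_swap]; exact km.aemeasurable
        _ = a * ∫⁻ y in Ω, (ENNReal.ofReal (4^n * K^n * l^n) * Icon n) * (‖ψ y‖ₑ ^ (n+1) * ENNReal.ofReal (d y)⁻¹ ^ n) := by
            congr 1
            refine setLIntegral_congr_fun hΩ fun y hy => ?_
            have hdy := (G.mem y).1 hy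
            rw [lintegral_const_mul' _ _ (by finiteness), kernel_int hK (by positivity), ← ENNReal.ofReal_pow (by positivity),
              show 4^n * K^n * (d y / l)⁻¹ ^ n = (4^n * K^n * l^n) * (d y)⁻¹ ^ n by
                rw [inv_div, div_eq_mul_inv, mul_pow]; ring, ENNReal.ofReal_mul (by positivity)]
            ring
        _ = (a * (ENNReal.ofReal (4^n * K^n * l^n) * Icon n)) * Hen n Ω d ψ := by
            rw [lintegral_const_mul' _ _ (by finiteness), Hen, ← mul_assoc a]
        _ ≤ _ := by gcongr
  have fin : Hen n Ω d ψ ≤ 2 * (S2 * (∫⁻ x in Ω, ‖ψ x‖ₑ ^ (n+1)) + S1 * Sen n Ω ψ) := by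
    set H := Hen n Ω d ψ
    set R := S2 * (∫⁻ x in Ω, ‖ψ x‖ₑ ^ (n+1)) + S1 * Sen n Ω ψ with hR
    rw [← add_assoc, ← hR] at main
    have h2 : H = 2⁻¹ * H + 2⁻¹ * H := by rw [← add_mul, ENNReal.inv_two_add_inv_two, one_mul]
    have h3 : 2⁻¹ * H + 2⁻¹ * H ≤ R + 2⁻¹ * H := by rw [← h2]; exact main
    have h4 : 2⁻¹ * H ≤ R := (ENNReal.add_le_add_iff_right (by finiteness)).1 h3
    calc H = 2 * (2⁻¹ * H) := by rw [← mul_assoc, ENNReal.mul_inv_cancel (by norm_num) (by norm_num), one_mul]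
      _ ≤ _ := by gcongr
  refine fin.trans ?_
  calc _ ≤ 2 * ((S1 + S2) * (∫⁻ x in Ω, ‖ψ x‖ₑ ^ (n+1)) + (S1 + S2) * Sen n Ω ψ) :=
        mul_le_mul' le_rfl (add_le_add (mul_le_mul' le_add_self le_rfl) (mul_le_mul' le_self_add le_rfl))
    _ = _ := by ring

theorem Hen_lt {n : ℕ} {Ω : Set (Euc n)} {d : Euc n → ℝ} {c r : ℝ} (G : Geom n Ω d c r)
    (hΩ : MeasurableSet Ω) (hΩb : Bornology.IsBounded Ω) {ψ : Euc n → ℝ} (hψ : Cc1 n Ω ψ) : Hen n Ω d ψ ≠ ⊤ := by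
  obtain ⟨h1, h2, h3⟩ := hψ
  have hdc : Continuous d := G.smooth.continuous
  -- the integrand is bounded by a constant
  have hcont : ContinuousOn (fun x => ‖ψ x‖ ^ (n+1) * (d x)⁻¹ ^ n) (tsupport ψ) := by
    refine ((h1.continuous.norm.pow _).continuousOn).mul ((hdc.continuousOn.inv₀ ?_).pow _)
    intro x hx; exact ((G.mem x).1 (h3 hx)).ne'
  obtain ⟨M, hM⟩ := h2.isCompact.exists_bound_of_continuousOn hcont
  have hle : Hen n Ω d ψ ≤ ∫⁻ x in Ω, ENNReal.ofReal M := by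
    refine setLIntegral_mono' hΩ fun x hx => ?_
    by_cases hxs : x ∈ tsupport ψ
    · have hd := (G.mem x).1 hx
      rw [← ofReal_norm, ← ENNReal.ofReal_pow (by positivity), ← ENNReal.ofReal_pow (by positivity), ← ENNReal.ofReal_mul (by positivity)]
      exact ENNReal.ofReal_le_ofReal ((le_abs_self _).trans (hM x hxs))
    · rw [image_eq_zero_of_notMem_tsupport hxs]; simp
  refine ne_of_lt (hle.trans_lt ?_)
  rw [setLIntegral_const]
  exact ENNReal.mul_lt_top ENNReal.ofReal_lt_top hΩb.measure_lt_top

/-- components of the zero extension -/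
def comp0 {n : ℕ} (Ω : Set (Euc n)) (u : Euc n → Euc n) (i : Fin n) (x : Euc n) : ℝ := Ω.indicator u x i

theorem ind_meas {n : ℕ} {Ω : Set (Euc n)} (hΩo : IsOpen Ω) {u : Euc n → Euc n} (hu : ContinuousOn u Ω) :
    Measurable (Ω.indicator u) := by
  classical
  have := ContinuousOn.measurable_piecewise hu (continuousOn_const (c := (0 : Euc n)) (s := Ωᶜ)) hΩo.measurableSet
  convert this using 1
  ext x i
  by_cases h : x ∈ Ω <;> simp [h]

theorem coord_meas {n : ℕ} (i : Fin n) : Measurable (fun v : Euc n => v i) := by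
  have : Continuous (fun v : Euc n => v i) := by fun_prop
  exact this.measurable

theorem comp0_locInt {n : ℕ} {Ω : Set (Euc n)} (hΩo : IsOpen Ω) (hΩb : Bornology.IsBounded Ω) {u : Euc n → Euc n}
    (hu : ContinuousOn u (closure Ω)) (i : Fin n) : LocallyIntegrable (comp0 Ω u i) := by
  have hm : Measurable (comp0 Ω u i) := (coord_meas i).comp (ind_meas hΩo (hu.mono subset_closure))
  obtain ⟨M, hM⟩ := hΩb.isCompact_closure.exists_bound_of_continuousOn hu
  refine Integrable.locallyIntegrable ?_
  have hi : Integrable (Ω.indicator (fun _ => M) : Euc n → ℝ) :=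
    (integrable_indicator_iff hΩo.measurableSet).2 (integrableOn_const hΩb.measure_lt_top.ne)
  refine hi.mono' hm.aestronglyMeasurable (Eventually.of_forall fun x => ?_)
  by_cases h : x ∈ Ω
  · rw [Set.indicator_of_mem h, comp0, Set.indicator_of_mem h]
    exact (PiLp.norm_apply_le _ _).trans (hM x (subset_closure h))
  · simp [comp0, h]

theorem Sen_congr {n : ℕ} {Ω : Set (Euc n)} (hΩ : MeasurableSet Ω) {F : Type*} [NormedAddCommGroup F] {f g : Euc n → F}
    (h : ∀ x ∈ Ω, f x = g x) : Sen n Ω f = Sen n Ω g := by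
  refine setLIntegral_congr_fun hΩ fun x hx => ?_
  refine setLIntegral_congr_fun hΩ fun y hy => ?_
  simp only [h x hx, h y hy]

theorem holder_main {n : ℕ} (hn : 1 ≤ n) : ∃ C : ENNReal, C ≠ ⊤ ∧ ∀ {Ω : Set (Euc n)} {d : Euc n → ℝ} {c r : ℝ},
    Geom n Ω d c r → IsOpen Ω → Bornology.IsBounded Ω → ∀ (ψ : Euc n → ℝ) (u : Euc n → Euc n),
    ContinuousOn u (closure Ω) →
    ∫⁻ z in Set.Ioi 0 ×ˢ Set.univ, ‖fderiv ℝ (Psi n d ψ) z‖ₑ * ∏ i, ‖fderiv ℝ (moll n (comp0 Ω u i)) z‖ₑ ≤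
      (∫⁻ z in Set.Ioi 0 ×ˢ Set.univ, ‖fderiv ℝ (Psi n d ψ) z‖ₑ ^ (n+1)) ^ (1 / ((n:ℝ)+1)) *
        (C * Sen n Ω u) ^ ((n:ℝ) / ((n:ℝ)+1)) := by
  obtain ⟨C, hC, hE⟩ := moll_energy hn
  refine ⟨C, hC, fun {Ω d c r} G hΩo hΩb ψ u hu => ?_⟩
  have hdc : Continuous d := G.smooth.continuous
  have hn0 : (0:ℝ) < n := by exact_mod_cast hn
  have hpq : ((n:ℝ)+1).HolderConjugate (((n:ℝ)+1)/n) := by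
    rw [Real.holderConjugate_iff]
    refine ⟨by linarith, ?_⟩
    field_simp
    ring
  have hz0 : ‖(0 : ℝ × Euc n →L[ℝ] ℝ)‖ₑ = 0 := by rw [← ofReal_norm, norm_zero, ENNReal.ofReal_zero]
  set f : ℝ × Euc n → ENNReal := fun z => ‖fderiv ℝ (Psi n d ψ) z‖ₑ with hf
  set P : ℝ × Euc n → ENNReal := fun z => ∏ i, ‖fderiv ℝ (moll n (comp0 Ω u i)) z‖ₑ with hP
  set g := (Qset n d).indicator P with hg
  have fm : Measurable f := (measurable_fderiv ℝ _).enorm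
  have Pm : Measurable P := Finset.measurable_prod _ fun i _ => (measurable_fderiv ℝ _).enorm
  have gm : Measurable g := Pm.indicator (Qset_meas G)
  have hle : ∀ z ∈ Set.Ioi (0:ℝ) ×ˢ (Set.univ : Set (Euc n)), f z * P z ≤ (f * g) z := by
    intro z hz
    have hz1 : 0 < z.1 := hz.1
    by_cases hQ : z ∈ Qset n d
    · rw [Pi.mul_apply, hg, Set.indicator_of_mem hQ]
    · have : d z.2 ≤ z.1 := by
        by_contra h; exact hQ ⟨hz1, not_le.1 h⟩
      rw [hf]; simp only
      rw [Psi_fderiv_zero hdc hz1 (by linarith), hz0, zero_mul]; exact zero_le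
  refine (setLIntegral_mono' (isOpen_half n).measurableSet hle).trans ?_
  refine (ENNReal.lintegral_mul_le_Lp_mul_Lq _ hpq fm.aemeasurable gm.aemeasurable).trans ?_
  have e1 : ∀ z, f z ^ ((n:ℝ)+1) = f z ^ (n+1) := fun z => by
    rw [← ENNReal.rpow_natCast]; norm_cast
  simp only [e1]
  rw [one_div_div]
  refine mul_le_mul' le_rfl (ENNReal.rpow_le_rpow ?_ (by positivity))
  have e2 : ∀ z, g z ^ (((n:ℝ)+1)/n) ≤ (Qset n d).indicator (fun z => C * Jn n (Ω.indicator u) z) z := by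
    intro z
    by_cases hQ : z ∈ Qset n d
    · rw [hg, Set.indicator_of_mem hQ, Set.indicator_of_mem hQ]
      have hb : ∀ i, ‖fderiv ℝ (moll n (comp0 Ω u i)) z‖ₑ ≤ (C * Jn n (Ω.indicator u) z) ^ (1/((n:ℝ)+1)) := by
        intro i
        have h1 := (hE _ (comp0_locInt hΩo hΩb hu i) z.1 hQ.1 z.2).1
        have h2 : Jn n (comp0 Ω u i) z ≤ Jn n (Ω.indicator u) z := by
          unfold Jn
          gcongr with y
          rw [← ofReal_norm, ← ofReal_norm]
          refine ENNReal.ofReal_le_ofReal ?_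
          exact PiLp.norm_apply_le (Ω.indicator u y - Ω.indicator u z.2) i
        have h3 : ‖fderiv ℝ (moll n (comp0 Ω u i)) z‖ₑ ^ ((n:ℝ)+1) ≤ C * Jn n (Ω.indicator u) z := by
          refine le_trans (le_of_eq ?_) (h1.trans (mul_le_mul' le_rfl h2))
          rw [← ENNReal.rpow_natCast]; norm_cast
        rw [one_div, ENNReal.le_rpow_inv_iff (by positivity)]; exact h3
      have hprod : P z ≤ ((C * Jn n (Ω.indicator u) z) ^ (1/((n:ℝ)+1))) ^ n := by
        calc P z ≤ ∏ _i : Fin n, (C * Jn n (Ω.indicator u) z) ^ (1/((n:ℝ)+1)) := Finset.prod_le_prod' fun i _ => hb i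
          _ = _ := by simp
      calc P z ^ (((n:ℝ)+1)/n) ≤ (((C * Jn n (Ω.indicator u) z) ^ (1/((n:ℝ)+1))) ^ n) ^ (((n:ℝ)+1)/n) :=
            ENNReal.rpow_le_rpow hprod (by positivity)
        _ = C * Jn n (Ω.indicator u) z := by
          rw [← ENNReal.rpow_natCast, ← ENNReal.rpow_mul, ← ENNReal.rpow_mul,
            show 1 / ((n:ℝ)+1) * (n * (((n:ℝ)+1)/n)) = 1 by field_simp, ENNReal.rpow_one]
    · rw [hg, Set.indicator_of_notMem hQ, Set.indicator_of_notMem hQ, ENNReal.zero_rpow_of_pos (by positivity)]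
  calc _ ≤ ∫⁻ z, g z ^ (((n:ℝ)+1)/n) := setLIntegral_le_lintegral _ _
    _ ≤ ∫⁻ z, (Qset n d).indicator (fun z => C * Jn n (Ω.indicator u) z) z := lintegral_mono e2
    _ = C * ∫⁻ z in Qset n d, Jn n (Ω.indicator u) z := by
      rw [lintegral_indicator (Qset_meas G), lintegral_const_mul' _ _ hC]
    _ ≤ C * Sen n Ω (Ω.indicator u) := by
      gcongr; exact energy_le hn G hΩo.measurableSet (ind_meas hΩo (hu.mono subset_closure))
    _ = C * Sen n Ω u := by
      rw [Sen_congr hΩo.measurableSet fun x hx => Set.indicator_of_mem hx u]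

theorem limit_main {n : ℕ} {Ω : Set (Euc n)} {d : Euc n → ℝ} {c r : ℝ}
    (G : Geom n Ω d c r) (hΩo : IsOpen Ω) (hΩb : Bornology.IsBounded Ω) {ψ : Euc n → ℝ} {u : Euc n → Euc n}
    (hu : ContDiffOn ℝ 1 u (closure Ω)) (hψ : Cc1 n Ω ψ) :
    Tendsto (fun ε => ∫ x, Psi n d ψ (ε, x) * (Matrix.of fun i j => fderiv ℝ (moll n (comp0 Ω u i)) (ε, x)
      (0, EuclideanSpace.single j 1)).det) (𝓝[>] 0) (𝓝 (∫ x in Ω, (jacMat n u x).det * ψ x)) := by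
  obtain ⟨M, hM0, hM⟩ := G.lipschitz hΩo hΩb hu
  obtain ⟨C1, hC1, hb1⟩ := moll_fderiv_bound n
  obtain ⟨C2, hC2, hb2⟩ := moll_bound n
  have hψc : Continuous ψ := hψ.1.continuous
  have hψl : LocallyIntegrable ψ := hψc.locallyIntegrable
  obtain ⟨N, hN⟩ := hψ.2.1.exists_bound_of_continuous hψc
  have hN0 : 0 ≤ N := (norm_nonneg _).trans (hN 0)
  have hgl := fun i => comp0_locInt hΩo hΩb hu.continuousOn i
  set V := ballVol n with hV
  have hV0 : 0 ≤ V := ENNReal.toReal_nonneg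
  have hdc : Continuous d := G.smooth.continuous
  have integ_bound : ∀ (h : Euc n → ℝ) (B : ℝ) (x : Euc n) (t : ℝ), 0 < t → (∀ y ∈ closedBall x t, |h y| ≤ B) →
      ∫ y in closedBall x t, |h y| ≤ B * (t^n * V) := by
    intro h B x t ht hB
    have := norm_setIntegral_le_of_norm_le_const (f := fun y => |h y|) (μ := (volume : Measure (Euc n))) (s := closedBall x t) (C := B)
      measure_closedBall_lt_top (fun y hy => by rw [Real.norm_eq_abs, abs_abs]; exact hB y hy)
    rw [Measure.real, volume_closedBall_real x ht] at this
    exact (le_abs_self _).trans this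
  set D : ℝ := C1 * M * V with hD
  have hdet : ∀ t x, 0 < t → 2 * t < d x → |(Matrix.of fun i j => fderiv ℝ (moll n (comp0 Ω u i)) (t, x)
      (0, EuclideanSpace.single j 1)).det| ≤ n.factorial * D ^ n := by
    intro t x ht htd
    have hxΩ : x ∈ Ω := (G.mem x).2 (by linarith)
    have := Matrix.det_le (A := (Matrix.of fun i j => fderiv ℝ (moll n (comp0 Ω u i)) (t, x)
      (0, EuclideanSpace.single j (1:ℝ)))) (abv := AbsoluteValue.abs) (x := D) (fun i j => by
        simp only [Matrix.of_apply]
        have b := hb1 _ (hgl i) t ht x (comp0 Ω u i x)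
        have b2 := integ_bound (fun y => comp0 Ω u i y - comp0 Ω u i x) (M * t) x t ht (fun y hy => by
          have hyx : dist y x ≤ t := hy
          have hy' : y ∈ Ω := G.mem_of_dist hxΩ (by linarith)
          simp only [comp0, Set.indicator_of_mem hxΩ, Set.indicator_of_mem hy']
          have := PiLp.norm_apply_le (u y - u x) i
          calc _ ≤ ‖u y - u x‖ := this
            _ ≤ M * dist y x := hM y hy' x hxΩ
            _ ≤ M * t := by gcongr)
        have hle := (fderiv ℝ (moll n (comp0 Ω u i)) (t, x)).le_opNorm (0, EuclideanSpace.single j (1:ℝ))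
        have hn1 : ‖((0:ℝ), EuclideanSpace.single j (1:ℝ))‖ ≤ 1 := by simp [Prod.norm_def]
        calc |fderiv ℝ (moll n (comp0 Ω u i)) (t, x) (0, EuclideanSpace.single j (1:ℝ))| 
            ≤ ‖fderiv ℝ (moll n (comp0 Ω u i)) (t, x)‖ * 1 := hle.trans (by gcongr)
          _ ≤ (C1 * t⁻¹ ^ (n+1) * (M * t * (t^n * V))) * 1 := by
            gcongr; exact b.trans (by gcongr)
          _ = D := by rw [hD, inv_pow, pow_succ]; field_simp)
    simpa [nsmul_eq_mul] using this
  have hPsi : ∀ t x, 0 < t → |Psi n d ψ (t, x)| ≤ C2 * N * V := by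
    intro t x ht
    rw [Psi, abs_mul]
    have p1 : |phi d (t, x)| ≤ 1 := by
      rw [phi, abs_of_nonneg (Real.smoothTransition.nonneg _)]; exact Real.smoothTransition.le_one _
    have b := hb2 ψ hψl t ht x 0
    simp only [sub_zero] at b
    have b2 := integ_bound ψ N x t ht (fun y _ => hN y)
    calc _ ≤ 1 * (C2 * t⁻¹ ^ n * (N * (t^n * V))) := by
          gcongr; exact b.trans (by gcongr)
      _ = _ := by rw [inv_pow]; field_simp
  have hzero : ∀ t x, 0 < t → d x ≤ 2 * t → Psi n d ψ (t, x) = 0 := fun t x ht h => by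
    rw [Psi, phi_zero (z := (t, x)) ht h, zero_mul]
  rw [← integral_indicator hΩo.measurableSet]
  refine tendsto_integral_filter_of_dominated_convergence (Ω.indicator fun _ => (C2 * N * V) * (n.factorial * D ^ n)) ?_ ?_ ?_ ?_
  · filter_upwards [self_mem_nhdsWithin] with ε hε
    have hε0 : 0 < ε := hε
    have m1 : Continuous (fun x => Psi n d ψ (ε, x)) := by
      refine continuous_iff_continuousAt.2 fun x => ?_
      have hq : (ε, x) ∈ Set.Ioi (0:ℝ) ×ˢ (Set.univ : Set (Euc n)) := ⟨hε0, trivial⟩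
      have := ((Psi_contDiffOn G.smooth hψl).continuousOn.continuousAt ((isOpen_half n).mem_nhds hq))
      exact ContinuousAt.comp (f := fun x : Euc n => (ε, x)) (g := Psi n d ψ) this (by fun_prop)
    refine (m1.measurable.mul ?_).aestronglyMeasurable
    simp only [Matrix.det_apply, Matrix.of_apply]
    refine Finset.measurable_sum _ fun σ _ => Measurable.const_smul (Finset.measurable_prod _ fun i _ => ?_) _
    exact (measurable_fderiv_apply_const ℝ (moll n (comp0 Ω u (σ i))) (0, EuclideanSpace.single i (1:ℝ))).comp measurable_prodMk_left
  · filter_upwards [self_mem_nhdsWithin] with ε hε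
    have hε0 : 0 < ε := hε
    refine Eventually.of_forall fun x => ?_
    rcases le_or_gt (d x) (2 * ε) with h | h
    · rw [hzero ε x hε0 h, zero_mul, norm_zero]
      refine Set.indicator_nonneg (fun _ _ => ?_) _
      positivity
    · have hxΩ : x ∈ Ω := (G.mem x).2 (by linarith)
      rw [Set.indicator_of_mem hxΩ, norm_mul]
      have := hPsi ε x hε0
      have := hdet ε x hε0 h
      simp only [Real.norm_eq_abs]
      gcongr
  · exact (integrable_indicator_iff hΩo.measurableSet).2 (integrableOn_const hΩb.measure_lt_top.ne)
  · refine Eventually.of_forall fun x => ?_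
    by_cases hx : x ∈ Ω
    · rw [Set.indicator_of_mem hx, mul_comm]
      have hdx := (G.mem x).1 hx
      refine Tendsto.mul ?_ ?_
      · refine (moll_tendsto hψl hψc.continuousAt).congr' ?_
        have : Set.Ioo (0:ℝ) (d x / 3) ∈ 𝓝[>] (0:ℝ) := Ioo_mem_nhdsGT (by positivity)
        filter_upwards [this] with t ht
        rw [Psi, phi_one (z := (t, x)) ht.1 (by have := ht.2; simp only; linarith), one_mul]
      · refine ((continuous_id.matrix_det).tendsto (jacMat n u x)).comp ?_
        refine tendsto_pi_nhds.2 fun i => tendsto_pi_nhds.2 fun j => ?_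
        have hud : HasFDerivAt u (fderiv ℝ u x) x :=
          ((hu.contDiffAt (mem_of_superset (hΩo.mem_nhds hx) subset_closure)).differentiableAt (by simp)).hasFDerivAt
        have hcd : HasFDerivAt (comp0 Ω u i) ((EuclideanSpace.proj i : Euc n →L[ℝ] ℝ).comp (fderiv ℝ u x)) x := by
          have := (EuclideanSpace.proj (𝕜 := ℝ) i : Euc n →L[ℝ] ℝ).hasFDerivAt.comp x hud
          refine this.congr_of_eventuallyEq ?_
          filter_upwards [hΩo.mem_nhds hx] with y hy
          simp [comp0, hy]
        exact fderiv_moll_tendsto (hgl i) hcd (EuclideanSpace.single j 1)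
    · rw [Set.indicator_of_notMem hx]
      refine tendsto_const_nhds.congr' ?_
      filter_upwards [self_mem_nhdsWithin] with t ht
      have ht0 : 0 < t := ht
      have : d x ≤ 0 := not_lt.1 fun h => hx ((G.mem x).2 h)
      rw [hzero t x ht0 (by linarith), zero_mul]

theorem main_enorm {n : ℕ} (hn : 2 ≤ n) {Ω : Set (Euc n)} (hΩo : IsOpen Ω) (hΩb : Bornology.IsBounded Ω)
    {d : Euc n → ℝ} {c r : ℝ} (G : Geom n Ω d c r) : ∃ C : ENNReal, C ≠ ⊤ ∧ ∀ (u : Euc n → Euc n) (ψ : Euc n → ℝ),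
      ContDiffOn ℝ 1 u (closure Ω) → Cc1 n Ω ψ → ‖∫ x in Ω, (jacMat n u x).det * ψ x‖ₑ ≤
      C * Sen n Ω u ^ ((n:ℝ) / ((n:ℝ)+1)) * (Sen n Ω ψ + ∫⁻ x in Ω, ‖ψ x‖ₑ ^ (n+1)) ^ (1 / ((n:ℝ)+1)) := by
  obtain ⟨C1, hC1, h1⟩ := holder_main (n := n) (by omega)
  obtain ⟨C2, hC2, h2⟩ := grad_Psi_int (n := n) (by omega)
  obtain ⟨C3, hC3, h3⟩ := hardy hn G hΩo.measurableSet
  refine ⟨(n+1).factorial * (C1 ^ ((n:ℝ) / ((n:ℝ)+1)) * (C2 * (1 + C3)) ^ (1 / ((n:ℝ)+1))), ?_, ?_⟩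
  · refine ENNReal.mul_ne_top (ENNReal.natCast_ne_top _) (ENNReal.mul_ne_top ?_ ?_)
    · exact ENNReal.rpow_ne_top_of_nonneg (by positivity) hC1
    · exact ENNReal.rpow_ne_top_of_nonneg (by positivity) (by finiteness)
  intro u ψ hu hψ
  have hψc : Continuous ψ := hψ.1.continuous
  have hψl : LocallyIntegrable ψ := hψc.locallyIntegrable
  have hgl := fun i => comp0_locInt hΩo hΩb hu.continuousOn i
  obtain ⟨R0, hR0⟩ := hΩb.exists_norm_le
  have hzero : ∀ t x, 0 < t → d x ≤ 2 * t → Psi n d ψ (t, x) = 0 := fun t x ht h => by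
    rw [Psi, phi_zero (z := (t, x)) ht h, zero_mul]
  have hlim := (limit_main G hΩo hΩb hu hψ).enorm
  refine le_of_tendsto hlim ?_
  have : Set.Ioo (0:ℝ) 1 ∈ 𝓝[>] (0:ℝ) := Ioo_mem_nhdsGT one_pos
  filter_upwards [this] with ε hε
  have hle2 : (2 : WithTop ℕ∞) ≤ ((⊤:ℕ∞) : WithTop ℕ∞) := by
    exact WithTop.coe_le_coe.2 (le_top : (2:ℕ∞) ≤ ⊤)
  have key := piola_main (n := n) (W := fun i => moll n (comp0 Ω u i)) (Ψ := Psi n d ψ)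
    (fun i => (moll_contDiffOn (hgl i)).of_le hle2) ((Psi_contDiffOn G.smooth hψl).of_le (by exact_mod_cast le_top))
    (R := |R0| + 1) (by positivity) (fun t x ht => hzero t x (by linarith) (by
      by_cases hx : x ∈ Ω
      · have := G.le_one x hx; linarith
      · have : d x ≤ 0 := not_lt.1 fun h => hx ((G.mem x).2 h)
        linarith)) (fun t x ht hx => hzero t x ht (by
      have hx' : x ∉ Ω := fun h => by have := hR0 x h; have := le_abs_self R0; linarith
      have : d x ≤ 0 := not_lt.1 fun h => hx' ((G.mem x).2 h)
      linarith)) hε.1 hε.2.le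
  refine key.trans ?_
  have a1 := h1 G hΩo hΩb ψ u hu.continuousOn
  have a2 := h2 G hΩo.measurableSet ψ hψl hψc.measurable
  have a3 := h3 ψ hψc.measurable (Hen_lt G hΩo.measurableSet hΩb hψ)
  set L := ∫⁻ x in Ω, ‖ψ x‖ₑ ^ (n+1)
  have a4 : ∫⁻ z in Set.Ioi 0 ×ˢ Set.univ, ‖fderiv ℝ (Psi n d ψ) z‖ₑ ^ (n+1) ≤ (C2 * (1 + C3)) * (Sen n Ω ψ + L) := by
    refine a2.trans ?_
    rw [mul_assoc]
    refine mul_le_mul' le_rfl ?_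
    rw [add_mul, one_mul]
    exact add_le_add le_self_add a3
  calc _ ≤ ((n+1).factorial : ENNReal) * (((C2 * (1 + C3)) * (Sen n Ω ψ + L)) ^ (1 / ((n:ℝ)+1)) * (C1 * Sen n Ω u) ^ ((n:ℝ) / ((n:ℝ)+1))) := by
        refine mul_le_mul' le_rfl (a1.trans (mul_le_mul' (ENNReal.rpow_le_rpow a4 (by positivity)) le_rfl))
    _ = _ := by
        rw [ENNReal.mul_rpow_of_nonneg _ _ (by positivity), ENNReal.mul_rpow_of_nonneg _ (Sen n Ω u) (by positivity)]
        ring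

theorem riesz_fin {n : ℕ} (hn : 1 ≤ n) (R : ℝ) :
    ∫⁻ z in closedBall (0 : Euc n) R, ENNReal.ofReal (‖z‖⁻¹) ^ (n-1) ≠ ⊤ := by
  have : Nonempty (Fin n) := ⟨⟨0, by omega⟩⟩
  have : Nontrivial (Euc n) := inferInstance
  have hi : Integrable (fun z : Euc n => (Set.Iic R).indicator (fun y : ℝ => y⁻¹ ^ (n-1)) ‖z‖) := by
    rw [integrable_fun_norm_addHaar (volume : Measure (Euc n)) (f := (Set.Iic R).indicator (fun y : ℝ => y⁻¹ ^ (n-1)))]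
    rw [finrank_euclideanSpace_fin]
    have : IntegrableOn (fun y : ℝ => (Set.Ioc 0 R).indicator (fun _ => (1:ℝ)) y) (Set.Ioi 0) :=
      ((integrable_indicator_iff measurableSet_Ioc).2 (integrableOn_const (by simp))).integrableOn
    refine this.congr_fun (fun y hy => ?_) measurableSet_Ioi
    have hy0 : 0 < y := hy
    beta_reduce
    by_cases h : y ≤ R
    · rw [Set.indicator_of_mem (show y ∈ Set.Ioc 0 R from ⟨hy0, h⟩)]
      simp only [Set.indicator_of_mem (show y ∈ Set.Iic R from h), smul_eq_mul]
      rw [← mul_pow, mul_inv_cancel₀ hy0.ne', one_pow]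
    · rw [Set.indicator_of_notMem (show y ∉ Set.Ioc 0 R from fun h' => h h'.2)]
      simp only [Set.indicator_of_notMem (show y ∉ Set.Iic R from h), smul_zero]
  have h2 := hi.lintegral_lt_top
  rw [← lintegral_indicator measurableSet_closedBall]
  refine ne_of_lt (lt_of_le_of_lt (lintegral_mono fun z => ?_) h2)
  by_cases hz : z ∈ closedBall (0 : Euc n) R
  · rw [Set.indicator_of_mem hz, Set.indicator_of_mem (show ‖z‖ ∈ Set.Iic R by simpa using hz),
      ENNReal.ofReal_pow (by positivity)]
  · rw [Set.indicator_of_notMem hz]; exact zero_le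

theorem Sen_lt {n : ℕ} (hn : 1 ≤ n) {Ω : Set (Euc n)} (hΩ : MeasurableSet Ω) (hΩb : Bornology.IsBounded Ω)
    {F : Type*} [NormedAddCommGroup F] {g : Euc n → F} {M : ℝ} (hM0 : 0 ≤ M)
    (hM : ∀ x ∈ Ω, ∀ y ∈ Ω, ‖g x - g y‖ ≤ M * dist x y) : Sen n Ω g ≠ ⊤ := by
  obtain ⟨R, hR⟩ := hΩb.exists_norm_le
  set J := ∫⁻ z in closedBall (0 : Euc n) (2*R), ENNReal.ofReal (‖z‖⁻¹) ^ (n-1) with hJ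
  have hJt : J ≠ ⊤ := riesz_fin hn _
  have hle : Sen n Ω g ≤ ∫⁻ x in Ω, ENNReal.ofReal M ^ (n+1) * J := by
    refine setLIntegral_mono' hΩ fun x hx => ?_
    calc _ ≤ ∫⁻ y in Ω, ENNReal.ofReal M ^ (n+1) * (closedBall (0 : Euc n) (2*R)).indicator (fun z => ENNReal.ofReal (‖z‖⁻¹) ^ (n-1)) (y - x) := by
          refine setLIntegral_mono' hΩ fun y hy => ?_
          have hmem : y - x ∈ closedBall (0 : Euc n) (2*R) := by
            rw [mem_closedBall_zero_iff]
            have := norm_sub_le y x; have := hR x hx; have := hR y hy; linarith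
          rw [Set.indicator_of_mem hmem, dist_eq_norm, norm_sub_rev y x]
          have h1 : ‖g x - g y‖ₑ ≤ ENNReal.ofReal M * ENNReal.ofReal ‖x - y‖ := by
            rw [← ofReal_norm, ← ENNReal.ofReal_mul hM0, ← dist_eq_norm x y]
            exact ENNReal.ofReal_le_ofReal (hM x hx y hy)
          set a := ENNReal.ofReal ‖x - y‖ with ha
          set b := ENNReal.ofReal ‖x - y‖⁻¹ with hb
          have hab : a * b ≤ 1 := by
            rw [ha, hb, ← ENNReal.ofReal_mul (norm_nonneg _), ← ENNReal.ofReal_one]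
            exact ENNReal.ofReal_le_ofReal (mul_inv_le_one)
          calc _ ≤ (ENNReal.ofReal M * a) ^ (n+1) * b ^ (2*n) := by gcongr
            _ = ENNReal.ofReal M ^ (n+1) * ((a * b) ^ (n+1) * b ^ (n-1)) := by
              rw [show 2 * n = (n+1) + (n-1) by omega, pow_add, mul_pow, mul_pow]; ring
            _ ≤ ENNReal.ofReal M ^ (n+1) * (1 ^ (n+1) * b ^ (n-1)) := by gcongr
            _ = _ := by rw [one_pow, one_mul]
      _ = ENNReal.ofReal M ^ (n+1) * ∫⁻ y in Ω, (closedBall (0 : Euc n) (2*R)).indicator (fun z => ENNReal.ofReal (‖z‖⁻¹) ^ (n-1)) (y - x) :=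
          lintegral_const_mul' _ _ (by finiteness)
      _ ≤ ENNReal.ofReal M ^ (n+1) * ∫⁻ y, (closedBall (0 : Euc n) (2*R)).indicator (fun z => ENNReal.ofReal (‖z‖⁻¹) ^ (n-1)) (y - x) := by
          gcongr; exact Measure.restrict_le_self
      _ = _ := by
          rw [lintegral_sub_right_eq_self (μ := (volume : Measure (Euc n))) ((closedBall (0 : Euc n) (2*R)).indicator (fun z => ENNReal.ofReal (‖z‖⁻¹) ^ (n-1))) x,
            lintegral_indicator measurableSet_closedBall]
  refine ne_of_lt (hle.trans_lt ?_)
  rw [setLIntegral_const]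
  exact ENNReal.mul_lt_top (by finiteness) hΩb.measure_lt_top

theorem sobSemi_eq {n : ℕ} {Ω : Set (Euc n)} 
    {F : Type*} [NormedAddCommGroup F] [MeasurableSpace F] [BorelSpace F] [SecondCountableTopology F]
    {g : Euc n → F} (hg : Measurable g) (hfin : Sen n Ω g ≠ ⊤) :
    sobSemi n ((n : ℝ) / ((n : ℝ) + 1)) ((n : ℝ) + 1) Ω g = (Sen n Ω g).toReal ^ (1 / ((n:ℝ)+1)) := by
  have e : ∀ x y, ‖g x - g y‖ ^ ((n:ℝ)+1) / dist x y ^ ((n : ℝ) + (n : ℝ) / ((n : ℝ) + 1) * ((n : ℝ) + 1)) =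
      (‖g x - g y‖ₑ ^ (n+1) * ENNReal.ofReal (dist x y)⁻¹ ^ (2*n)).toReal := by
    intro x y
    rw [div_mul_cancel₀ _ (by positivity), show (n:ℝ)+1 = ((n+1 : ℕ) : ℝ) by push_cast; ring, Real.rpow_natCast,
      show (n:ℝ)+n = ((2*n : ℕ) : ℝ) by push_cast; ring, Real.rpow_natCast, ENNReal.toReal_mul, ENNReal.toReal_pow, ENNReal.toReal_pow,
      ENNReal.toReal_ofReal (by positivity), toReal_enorm, inv_pow, div_eq_mul_inv]
  have fm : Measurable (fun q : Euc n × Euc n => ‖g q.1 - g q.2‖ₑ ^ (n+1) * ENNReal.ofReal (dist q.1 q.2)⁻¹ ^ (2*n)) := by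
    fun_prop
  have inner : ∀ x, ∫ y in Ω, (‖g x - g y‖ₑ ^ (n+1) * ENNReal.ofReal (dist x y)⁻¹ ^ (2*n)).toReal =
      (∫⁻ y in Ω, ‖g x - g y‖ₑ ^ (n+1) * ENNReal.ofReal (dist x y)⁻¹ ^ (2*n)).toReal := by
    intro x
    refine integral_toReal (fm.comp measurable_prodMk_left).aemeasurable (Eventually.of_forall fun y => ?_)
    finiteness
  unfold sobSemi
  simp only [e, inner]
  congr 1
  have sm : Measurable fun x => ∫⁻ y in Ω, ‖g x - g y‖ₑ ^ (n+1) * ENNReal.ofReal (dist x y)⁻¹ ^ (2*n) :=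
    Measurable.lintegral_prod_right' fm
  exact integral_toReal sm.aemeasurable (ae_lt_top sm hfin)

theorem sobSemi_congr {n : ℕ} {s p : ℝ} {Ω : Set (Euc n)} (hΩ : MeasurableSet Ω) {F : Type*} [NormedAddCommGroup F] {f g : Euc n → F}
    (h : ∀ x ∈ Ω, f x = g x) : sobSemi n s p Ω f = sobSemi n s p Ω g := by
  unfold sobSemi
  congr 1
  refine setIntegral_congr_fun hΩ fun x hx => ?_
  refine setIntegral_congr_fun hΩ fun y hy => ?_
  simp only [h x hx, h y hy]

theorem Lp_eq {n : ℕ} {Ω : Set (Euc n)} {ψ : Euc n → ℝ} (hψ : Measurable ψ) :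
    ∫ x in Ω, ‖ψ x‖ ^ ((n:ℝ)+1) = (∫⁻ x in Ω, ‖ψ x‖ₑ ^ (n+1)).toReal := by
  rw [← integral_toReal (by fun_prop) (Eventually.of_forall fun y => by finiteness)]
  refine integral_congr_ae (Eventually.of_forall fun x => ?_)
  simp only
  rw [ENNReal.toReal_pow, toReal_enorm, show (n:ℝ)+1 = ((n+1 : ℕ) : ℝ) by push_cast; ring, Real.rpow_natCast]

theorem jac_final
    (n : ℕ) (hn : 2 ≤ n) (Ω : Set (Euc n)) (hΩo : IsOpen Ω)
    (hΩb : Bornology.IsBounded Ω) (hΩs : SmoothBoundary n Ω) :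
    ∃ C : ℝ, 0 < C ∧ ∀ (u : Euc n → Euc n) (ψ : Euc n → ℝ),
      ContDiffOn ℝ 1 u (closure Ω) → Cc1 n Ω ψ →
      |∫ x in Ω, (jacMat n u x).det * ψ x| ≤
        C * sobNorm n ((n : ℝ) / ((n : ℝ) + 1)) ((n : ℝ) + 1) Ω u ^ n *
          sobNorm n ((n : ℝ) / ((n : ℝ) + 1)) ((n : ℝ) + 1) Ω ψ := by
  obtain ⟨d, c, r, G⟩ := exists_geom n Ω hΩo hΩb hΩs
  obtain ⟨C, hC, hmain⟩ := main_enorm hn hΩo hΩb G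
  refine ⟨C.toReal + 1, by positivity, fun u ψ hu hψ => ?_⟩
  have hΩm := hΩo.measurableSet
  have hn1 : 1 ≤ n := by omega
  have key := hmain u ψ hu hψ
  have hψc : Continuous ψ := hψ.1.continuous
  obtain ⟨M1, hM10, hM1⟩ := G.lipschitz hΩo hΩb hu
  obtain ⟨M2, hM20, hM2⟩ := G.lipschitz hΩo hΩb (hψ.1.contDiffOn (s := closure Ω))
  have fu := Sen_lt hn1 hΩm hΩb hM10 hM1
  have fψ := Sen_lt hn1 hΩm hΩb hM20 hM2
  have su : sobSemi n ((n : ℝ) / ((n : ℝ) + 1)) ((n : ℝ) + 1) Ω u = (Sen n Ω u).toReal ^ (1 / ((n:ℝ)+1)) := by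
    have hc : ∀ x ∈ Ω, Ω.indicator u x = u x := fun x hx => Set.indicator_of_mem hx u
    have hS := Sen_congr hΩm hc
    rw [← sobSemi_congr hΩm hc, ← hS]
    exact sobSemi_eq (ind_meas hΩo (hu.continuousOn.mono subset_closure)) (by rw [hS]; exact fu)
  have sψ := sobSemi_eq hψc.measurable fψ
  have lψ := Lp_eq (Ω := Ω) hψc.measurable
  set L := ∫⁻ x in Ω, ‖ψ x‖ₑ ^ (n+1) with hL
  have fL : L ≠ ⊤ := by
    obtain ⟨N, hN⟩ := hψ.2.1.exists_bound_of_continuous hψc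
    have : L ≤ ∫⁻ x in Ω, ENNReal.ofReal N ^ (n+1) := by
      refine lintegral_mono fun x => ?_
      gcongr
      rw [← ofReal_norm]; exact ENNReal.ofReal_le_ofReal (hN x)
    refine ne_of_lt (this.trans_lt ?_)
    rw [setLIntegral_const]
    exact ENNReal.mul_lt_top (by finiteness) hΩb.measure_lt_top
  have key2 : |∫ x in Ω, (jacMat n u x).det * ψ x| ≤ C.toReal * (Sen n Ω u).toReal ^ ((n:ℝ) / ((n:ℝ)+1)) *
      ((Sen n Ω ψ).toReal + L.toReal) ^ (1 / ((n:ℝ)+1)) := by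
    have ht : C * Sen n Ω u ^ ((n:ℝ) / ((n:ℝ)+1)) * (Sen n Ω ψ + L) ^ (1 / ((n:ℝ)+1)) ≠ ⊤ :=
      ENNReal.mul_ne_top (ENNReal.mul_ne_top hC (ENNReal.rpow_ne_top_of_nonneg (by positivity) fu))
        (ENNReal.rpow_ne_top_of_nonneg (by positivity) (by finiteness))
    have := ENNReal.toReal_mono ht key
    rw [toReal_enorm, ENNReal.toReal_mul, ENNReal.toReal_mul, ← ENNReal.toReal_rpow, ← ENNReal.toReal_rpow, ENNReal.toReal_add fψ fL] at this
    exact this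
  refine key2.trans ?_
  set a := (Sen n Ω u).toReal
  have ha : 0 ≤ a := ENNReal.toReal_nonneg
  set b := (Sen n Ω ψ).toReal
  have hb : 0 ≤ b := ENNReal.toReal_nonneg
  set l := L.toReal
  have hl : 0 ≤ l := ENNReal.toReal_nonneg
  have hp : 0 ≤ 1 / ((n:ℝ)+1) := by positivity
  have hp1 : 1 / ((n:ℝ)+1) ≤ 1 := by rw [div_le_one (by positivity)]; linarith [(Nat.cast_nonneg n : (0:ℝ) ≤ n)]
  have q1 : a ^ ((n:ℝ) / ((n:ℝ)+1)) ≤ sobNorm n ((n : ℝ) / ((n : ℝ) + 1)) ((n : ℝ) + 1) Ω u ^ n := by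
    rw [show (n:ℝ) / ((n:ℝ)+1) = 1 / ((n:ℝ)+1) * (n:ℝ) by ring, Real.rpow_mul ha, Real.rpow_natCast]
    refine pow_le_pow_left₀ (by positivity) ?_ _
    rw [show 1 / ((n:ℝ)+1) * (n:ℝ) = (n:ℝ) / ((n:ℝ)+1) by ring, sobNorm, su]
    have : 0 ≤ (∫ x in Ω, ‖u x‖ ^ ((n:ℝ)+1)) ^ (1 / ((n:ℝ)+1)) := by
      refine Real.rpow_nonneg (integral_nonneg fun x => by positivity) _
    linarith
  have q2 : (b + l) ^ (1 / ((n:ℝ)+1)) ≤ sobNorm n ((n : ℝ) / ((n : ℝ) + 1)) ((n : ℝ) + 1) Ω ψ := by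
    rw [sobNorm, sψ, lψ, add_comm b l]
    exact Real.rpow_add_le_add_rpow hl hb hp hp1
  have q0 : 0 ≤ a ^ ((n:ℝ) / ((n:ℝ)+1)) := by positivity
  have q3 : 0 ≤ (b + l) ^ (1 / ((n:ℝ)+1)) := by positivity
  refine mul_le_mul (mul_le_mul (by linarith) q1 q0 (by positivity)) q2 q3 ?_
  exact mul_nonneg (by positivity) (q0.trans q1)

/-- `Ju` extends to a bounded linear functional on `W^{n/(n+1),n+1}(Ω)`. -/
theorem jacobian_bounded_on_W_n_over_n_plus_one
    (n : ℕ) (hn : 2 ≤ n) (Ω : Set (Euc n)) (hΩo : IsOpen Ω)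
    (hΩb : Bornology.IsBounded Ω) (hΩs : SmoothBoundary n Ω) :
    ∃ C : ℝ, 0 < C ∧ ∀ (u : Euc n → Euc n) (ψ : Euc n → ℝ),
      ContDiffOn ℝ 1 u (closure Ω) → Cc1 n Ω ψ →
      |∫ x in Ω, (jacMat n u x).det * ψ x| ≤
        C * sobNorm n ((n : ℝ) / ((n : ℝ) + 1)) ((n : ℝ) + 1) Ω u ^ n *
          sobNorm n ((n : ℝ) / ((n : ℝ) + 1)) ((n : ℝ) + 1) Ω ψ := by
  exact jac_final n hn Ω hΩo hΩb hΩs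

end
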